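/- arXiv:1109.4986 — 3 statements merged into one kernel-verified Lean document; each statement's English description precedes it below -/
import Mathlib

section
/- Let m ≥ 3 and set A = {x_0,…,x_{k−1},y_{k+1},…,y_{2k}} and A' = {x_1,…,x_{k−1},y_{k+1},…,y_{2k−1}}. Let B₁⁺ be the set of degree-m monomials expressible as a product of m−1 variables from {x_0,x_k} and one variable from A, or as a product of m−1 variables from {x_k,y_{2k}} and one variable from A, or equal to x_k^m. Let B₂⁺ be the set of degree-m monomials expressible as a product of m−1 variables from {x_0,y_{2k}} and one variable from A', or as x_k times a product of m−2 variables from {x_0,y_{2k}} and one variable from A', or as a product of m variables from {x_0,y_{2k}}, or as x_k^r times a product of m−r variables from {x_0,y_{2k}} for r = 1, 2, 3. Then B₁⁺ and B₂⁺ are monomial bases of V_m, and for every integer weight vector ρ with ρ_0+⋯+ρ_{2k} = 0 their ρ-weights are w_ρ(B₁⁺) = ((m−1)²(g−1)−(2m−3))·ρ_k + (m(m−1)(g−1)/2 − 1)·(ρ_0+ρ_{2k}) and w_ρ(B₂⁺) = ((m−1)(g−1)+(2m−5))·ρ_k + ((m−1)²(g−1)−(2m−3))·(ρ_0+ρ_{2k}).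 (Lemma 4.5.) -/
/-!
Lemma 4.5 for the balanced ribbon: the explicit sets `B₁⁺` and `B₂⁺` of degree-`m`
monomials are monomial bases of `V_m`, and their `ρ`-weights are computed for every
one-parameter subgroup weight vector `ρ` with `ρ₀ + ⋯ + ρ_{2k} = 0`.
Here `g = 2k+1`, so `g - 1 = 2k`.
-/

noncomputable section

open scoped Classical

/-- The ring `ℂ[u][ε]/(ε²)`. -/
abbrev RibR : Type := DualNumber (Polynomial ℂ)

/-- The polynomial variable `u`. -/
def uPoly : Polynomial ℂ := Polynomial.X

/-- `x_i := u^i`. -/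
def xvar (i : ℕ) : RibR := TrivSqZeroExt.inl (uPoly ^ i)

/-- `y_j := u^j + (j-k)·u^(j-k-1)·ε` (intended for `j ≥ k+1`). -/
def yvar (k j : ℕ) : RibR :=
  TrivSqZeroExt.inl (uPoly ^ j) +
    TrivSqZeroExt.inr (((j - k : ℕ) : Polynomial ℂ) * uPoly ^ (j - k - 1))

/-- The ribbon variable attached to an index `i ∈ {0,…,2k}`. -/
def ribVar (k : ℕ) (i : Fin (2 * k + 1)) : RibR :=
  if (i : ℕ) ≤ k then xvar (i : ℕ) else yvar k (i : ℕ)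

/-- The element of `R` given by a monomial, encoded as a multiset of indices. -/
def monElem (k : ℕ) (σ : Multiset (Fin (2 * k + 1))) : RibR := (σ.map (ribVar k)).prod

/-- `V_m`: the `ℂ`-span of all degree-`m` monomials in the ribbon variables. -/
def ribSpan (k m : ℕ) : Submodule ℂ RibR :=
  Submodule.span ℂ
    {r : RibR | ∃ σ : Multiset (Fin (2 * k + 1)), Multiset.card σ = m ∧ r = monElem k σ}

/-- Degree-`m` monomials, as multisets of `m` indices. -/
abbrev DegMon (k m : ℕ) := Sym (Fin (2 * k + 1)) m

/-- A finite set of degree-`m` monomials is a monomial basis of `V_m` if its images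
in `R` are linearly independent over `ℂ` and span `V_m`. -/
def IsMonomialBasis (k m : ℕ) (S : Finset (DegMon k m)) : Prop :=
  LinearIndependent ℂ (fun s : S => monElem k (s : DegMon k m).1) ∧
  Submodule.span ℂ ((fun s : DegMon k m => monElem k s.1) '' S) = ribSpan k m

/-- The `ρ`-weight of a monomial. -/
def monWeight {k m : ℕ} (ρ : Fin (2 * k + 1) → ℤ) (σ : DegMon k m) : ℤ := (σ.1.map ρ).sum

/-- The `ρ`-weight of a finite set of monomials. -/
def setWeight {k m : ℕ} (ρ : Fin (2 * k + 1) → ℤ) (S : Finset (DegMon k m)) : ℤ :=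
  ∑ σ ∈ S, monWeight ρ σ

/-- Membership in `B₁⁺`: monomials which are a product of `m-1` variables from
`{x₀, x_k}` and one variable from `A = {x₀,…,x_{k-1},y_{k+1},…,y_{2k}}` (all variables
except `x_k`), or a product of `m-1` variables from `{x_k, y_{2k}}` and one variable
from `A`, or equal to `x_k^m`. -/
def memB1 (k m : ℕ) (σ : DegMon k m) : Prop :=
  (∃ j : Fin (2 * k + 1), (j : ℕ) ≠ k ∧ ∃ τ : Multiset (Fin (2 * k + 1)),
      Multiset.card τ = m - 1 ∧ (∀ i ∈ τ, (i : ℕ) = 0 ∨ (i : ℕ) = k) ∧ σ.1 = j ::ₘ τ) ∨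
  (∃ j : Fin (2 * k + 1), (j : ℕ) ≠ k ∧ ∃ τ : Multiset (Fin (2 * k + 1)),
      Multiset.card τ = m - 1 ∧ (∀ i ∈ τ, (i : ℕ) = k ∨ (i : ℕ) = 2 * k) ∧ σ.1 = j ::ₘ τ) ∨
  (∀ i ∈ σ.1, (i : ℕ) = k)

/-- Membership in `B₂⁺`: with `A' = {x₁,…,x_{k-1},y_{k+1},…,y_{2k-1}}` (all variables
except `x₀, x_k, y_{2k}`) and `D = {x₀, y_{2k}}`, the monomials which are a product of
`m-1` variables from `D` and one from `A'`, or `x_k` times a product of `m-2` variables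
from `D` and one from `A'`, or a product of `m` variables from `D`, or `x_k^r` times a
product of `m-r` variables from `D` for `r = 1, 2, 3`. -/
def memB2 (k m : ℕ) (σ : DegMon k m) : Prop :=
  (∃ j : Fin (2 * k + 1), ((j : ℕ) ≠ 0 ∧ (j : ℕ) ≠ k ∧ (j : ℕ) ≠ 2 * k) ∧
      ∃ τ : Multiset (Fin (2 * k + 1)),
        Multiset.card τ = m - 1 ∧ (∀ i ∈ τ, (i : ℕ) = 0 ∨ (i : ℕ) = 2 * k) ∧
        σ.1 = j ::ₘ τ) ∨
  (∃ j : Fin (2 * k + 1), ((j : ℕ) ≠ 0 ∧ (j : ℕ) ≠ k ∧ (j : ℕ) ≠ 2 * k) ∧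
      ∃ τ : Multiset (Fin (2 * k + 1)),
        Multiset.card τ = m - 2 ∧ (∀ i ∈ τ, (i : ℕ) = 0 ∨ (i : ℕ) = 2 * k) ∧
        σ.1 = j ::ₘ (⟨k, by omega⟩ : Fin (2 * k + 1)) ::ₘ τ) ∨
  (∀ i ∈ σ.1, (i : ℕ) = 0 ∨ (i : ℕ) = 2 * k) ∨
  (∃ r : ℕ, (r = 1 ∨ r = 2 ∨ r = 3) ∧ ∃ τ : Multiset (Fin (2 * k + 1)),
      Multiset.card τ = m - r ∧ (∀ i ∈ τ, (i : ℕ) = 0 ∨ (i : ℕ) = 2 * k) ∧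
      σ.1 = Multiset.replicate r (⟨k, by omega⟩ : Fin (2 * k + 1)) + τ)

/-- The variable index `j`, read modulo `2k+1`. -/
def ribIdx (k j : ℕ) : Fin (2 * k + 1) := Fin.ofNat (2 * k + 1) j

/-- The exponent of `u` in the reduced part of a monomial. -/
def monDeg {k : ℕ} (σ : Multiset (Fin (2 * k + 1))) : ℕ :=
  (σ.map fun i : Fin (2 * k + 1) => (i : ℕ)).sum

/-- The coefficient of the `ε`-part of a monomial. -/
def monEps {k : ℕ} (σ : Multiset (Fin (2 * k + 1))) : ℕ :=
  (σ.map fun i : Fin (2 * k + 1) => (i : ℕ) - k).sum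

theorem ribIdx_val {k j : ℕ} (h : j ≤ 2 * k) : (ribIdx k j : ℕ) = j := by
  simp only [ribIdx, Fin.val_ofNat]
  exact Nat.mod_eq_of_lt (by omega)

theorem ribIdx_coe {k : ℕ} (i : Fin (2 * k + 1)) : ribIdx k i = i :=
  Fin.ext (ribIdx_val (by omega))

theorem mk_eq_ribIdx {k j : ℕ} (h : j < 2 * k + 1) : (⟨j, h⟩ : Fin (2 * k + 1)) = ribIdx k j :=
  Fin.ext (ribIdx_val (by omega)).symm

theorem val_eq_iff_ribIdx {k j : ℕ} (h : j ≤ 2 * k) (i : Fin (2 * k + 1)) :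
    (i : ℕ) = j ↔ i = ribIdx k j := by
  rw [Fin.ext_iff, ribIdx_val h]

theorem fst_ribVar (k : ℕ) (i : Fin (2 * k + 1)) :
    (ribVar k i).fst = (Polynomial.X : Polynomial ℂ) ^ (i : ℕ) := by
  unfold ribVar xvar yvar uPoly
  split_ifs <;> simp

theorem snd_ribVar (k : ℕ) (i : Fin (2 * k + 1)) :
    (ribVar k i).snd * Polynomial.X ^ (k + 1) =
      (((i : ℕ) - k : ℕ) : Polynomial ℂ) * Polynomial.X ^ (i : ℕ) := by
  unfold ribVar xvar yvar uPoly
  split_ifs with h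
  · simp [Nat.sub_eq_zero_of_le h]
  · simp only [TrivSqZeroExt.snd_add, TrivSqZeroExt.snd_inl, TrivSqZeroExt.snd_inr, zero_add]
    rw [mul_assoc, ← pow_add]
    congr 2
    omega

theorem fst_monElem (k : ℕ) (σ : Multiset (Fin (2 * k + 1))) :
    (monElem k σ).fst = (Polynomial.X : Polynomial ℂ) ^ monDeg σ := by
  induction σ using Multiset.induction with
  | empty => simp [monElem, monDeg]
  | cons i σ ih =>
    simp only [monElem, monDeg, Multiset.map_cons, Multiset.prod_cons, Multiset.sum_cons,
      TrivSqZeroExt.fst_mul, pow_add] at ih ⊢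
    rw [ih, fst_ribVar]

theorem snd_monElem (k : ℕ) (σ : Multiset (Fin (2 * k + 1))) :
    (monElem k σ).snd * Polynomial.X ^ (k + 1) =
      (monEps σ : Polynomial ℂ) * Polynomial.X ^ monDeg σ := by
  induction σ using Multiset.induction with
  | empty => simp [monElem, monDeg, monEps]
  | cons i σ ih =>
    have hm : monElem k (i ::ₘ σ) = ribVar k i * monElem k σ := by simp [monElem]
    have hd : monDeg (i ::ₘ σ) = i + monDeg σ := by simp [monDeg]
    have he : monEps (i ::ₘ σ) = (i - k : ℕ) + monEps σ := by simp [monEps]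
    rw [hm, hd, he, TrivSqZeroExt.snd_mul, fst_monElem, fst_ribVar, smul_eq_mul,
      MulOpposite.smul_eq_mul_unop, MulOpposite.unop_op, pow_add]
    have h := snd_ribVar k i
    push_cast
    linear_combination Polynomial.X ^ (i : ℕ) * ih + Polynomial.X ^ monDeg σ * h

/-- A weighted sum of monomials that vanishes in `R` vanishes in each degree, both in its
reduced part and in its `ε`-part. -/
theorem sum_eq_zero_of_degree {k : ℕ} {ι : Type*} [Fintype ι]
    (F : ι → Multiset (Fin (2 * k + 1))) (a : ι → ℂ) (h : ∑ s, a s • monElem k (F s) = 0)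
    (d : ℕ) (e : ℂ) :
    ∑ s, (if d = monDeg (F s) then a s * (monEps (F s) - e) else 0) = 0 := by
  have h₁ := congrArg (fun r : RibR => (r.fst).coeff d) h
  have h₂ := congrArg (fun r : RibR => (r.snd * Polynomial.X ^ (k + 1)).coeff d) h
  simp only [TrivSqZeroExt.fst_sum, TrivSqZeroExt.fst_smul, fst_monElem, Polynomial.finsetSum_coeff,
    Polynomial.coeff_smul, Polynomial.coeff_X_pow, TrivSqZeroExt.fst_zero, Polynomial.coeff_zero,
    smul_eq_mul, mul_ite, mul_one, mul_zero] at h₁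
  simp only [TrivSqZeroExt.snd_sum, TrivSqZeroExt.snd_smul, Finset.sum_mul, smul_mul_assoc,
    snd_monElem, Polynomial.finsetSum_coeff, Polynomial.coeff_smul, Polynomial.coeff_natCast_mul,
    Polynomial.coeff_X_pow, TrivSqZeroExt.snd_zero, zero_mul, Polynomial.coeff_zero,
    smul_eq_mul, mul_ite, mul_one, mul_zero] at h₂
  calc _ = ∑ s, (if d = monDeg (F s) then a s * monEps (F s) else 0)
        - e * ∑ s, (if d = monDeg (F s) then a s else 0) := by
        rw [Finset.mul_sum, ← Finset.sum_sub_distrib]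
        refine Finset.sum_congr rfl fun s _ => ?_
        split_ifs <;> ring
    _ = 0 := by rw [h₁, h₂]; ring

theorem monElem_eq_of_eq {k : ℕ} {σ τ : Multiset (Fin (2 * k + 1))}
    (hd : monDeg σ = monDeg τ) (he : monEps σ = monEps τ) : monElem k σ = monElem k τ := by
  refine TrivSqZeroExt.ext (by rw [fst_monElem, fst_monElem, hd]) ?_
  refine mul_right_cancel₀ (pow_ne_zero (k + 1) Polynomial.X_ne_zero) ?_
  rw [snd_monElem, snd_monElem, hd, he]

theorem monElem_mem_span_pair {k : ℕ} {σ s t : Multiset (Fin (2 * k + 1))}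
    (hs : monDeg s = monDeg σ) (ht : monDeg t = monDeg σ) (he : monEps s ≠ monEps t) :
    monElem k σ ∈ Submodule.span ℂ {monElem k s, monElem k t} := by
  have he' : (monEps s : ℂ) - monEps t ≠ 0 := sub_ne_zero.mpr (by exact_mod_cast he)
  refine Submodule.mem_span_pair.mpr
    ⟨((monEps σ : ℂ) - monEps t) / (monEps s - monEps t),
      ((monEps s : ℂ) - monEps σ) / (monEps s - monEps t), ?_⟩
  generalize hα : ((monEps σ : ℂ) - monEps t) / (monEps s - monEps t) = α
  generalize hβ : ((monEps s : ℂ) - monEps σ) / (monEps s - monEps t) = β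
  have h₁ : α + β = 1 := by subst hα hβ; field_simp; ring
  have h₂ : α * monEps s + β * monEps t = monEps σ := by subst hα hβ; field_simp; ring
  refine TrivSqZeroExt.ext ?_ ?_
  · simp only [TrivSqZeroExt.fst_add, TrivSqZeroExt.fst_smul, fst_monElem, hs, ht]
    rw [← add_smul, h₁, one_smul]
  · refine mul_right_cancel₀ (pow_ne_zero (k + 1) Polynomial.X_ne_zero) ?_
    simp only [TrivSqZeroExt.snd_add, TrivSqZeroExt.snd_smul, add_mul, smul_mul_assoc,
      snd_monElem, hs, ht]
    rw [← Polynomial.C_eq_natCast, ← Polynomial.C_eq_natCast, ← Polynomial.C_eq_natCast,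
      Polynomial.smul_eq_C_mul, Polynomial.smul_eq_C_mul, ← mul_assoc, ← mul_assoc, ← add_mul,
      ← Polynomial.C_mul, ← Polynomial.C_mul, ← Polynomial.C_add, h₂]

theorem monEps_eq_zero_or (k : ℕ) (σ : Multiset (Fin (2 * k + 1))) :
    monEps σ = 0 ∨ k + 1 ≤ monDeg σ := by
  induction σ using Multiset.induction with
  | empty => simp [monEps]
  | cons i σ ih =>
    simp only [monEps, monDeg, Multiset.map_cons, Multiset.sum_cons] at ih ⊢
    omega

theorem monDeg_le (k : ℕ) (σ : Multiset (Fin (2 * k + 1))) :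
    monDeg σ ≤ 2 * (Multiset.card σ * k) := by
  induction σ using Multiset.induction with
  | empty => simp [monDeg]
  | cons i σ ih =>
    simp only [monDeg, Multiset.map_cons, Multiset.sum_cons, Multiset.card_cons, add_mul] at ih ⊢
    omega

theorem monEps_add_eq_or (k : ℕ) (σ : Multiset (Fin (2 * k + 1))) :
    monEps σ + Multiset.card σ * k = monDeg σ ∨
      monDeg σ + k + 1 ≤ 2 * (Multiset.card σ * k) := by
  induction σ using Multiset.induction with
  | empty => simp [monEps, monDeg]
  | cons i σ ih =>
    have h := monDeg_le k σ
    simp only [monEps, monDeg, Multiset.map_cons, Multiset.sum_cons, Multiset.card_cons,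
      add_mul] at ih h ⊢
    omega

/-- `S` is enumerated by degree: one monomial `f d` in each degree `0 ≤ d ≤ 2mk`, and a second
one `g d`, with a different `ε`-part, in each degree `k < d < 2mk - k`. -/
structure IsDegreeEnum (k m : ℕ) (S : Finset (DegMon k m))
    (f g : ℕ → Multiset (Fin (2 * k + 1))) : Prop where
  card_f : ∀ d ≤ 2 * (m * k), Multiset.card (f d) = m
  deg_f : ∀ d ≤ 2 * (m * k), monDeg (f d) = d
  card_g : ∀ d, k < d → d + k < 2 * (m * k) → Multiset.card (g d) = m
  deg_g : ∀ d, k < d → d + k < 2 * (m * k) → monDeg (g d) = d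
  eps_ne : ∀ d, k < d → d + k < 2 * (m * k) → monEps (f d) ≠ monEps (g d)
  mem_iff : ∀ σ : DegMon k m, σ ∈ S ↔ (∃ d ≤ 2 * (m * k), σ.1 = f d) ∨
    ∃ d, k < d ∧ d + k < 2 * (m * k) ∧ σ.1 = g d

namespace IsDegreeEnum

variable {k m : ℕ} {S : Finset (DegMon k m)} {f g : ℕ → Multiset (Fin (2 * k + 1))}

theorem exists_eps (h : IsDegreeEnum k m S f g) {s : DegMon k m} (hs : s ∈ S) :
    ∃ e : ℕ, monEps s.1 ≠ e ∧
      ∀ t ∈ S, monDeg s.1 = monDeg t.1 → t ≠ s → monEps t.1 = e := by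
  have key : ∀ t ∈ S, (monDeg t.1 ≤ 2 * (m * k) ∧ t.1 = f (monDeg t.1)) ∨
      (k < monDeg t.1 ∧ monDeg t.1 + k < 2 * (m * k) ∧ t.1 = g (monDeg t.1)) := by
    intro t ht
    rcases (h.mem_iff t).1 ht with ⟨d, hd, e⟩ | ⟨d, hd, hd', e⟩
    · left
      rw [e, h.deg_f d hd]
      exact ⟨hd, rfl⟩
    · right
      rw [e, h.deg_g d hd hd']
      exact ⟨hd, hd', rfl⟩
  rcases key s hs with ⟨hd, e⟩ | ⟨hd, hd', e⟩
  · by_cases hr : k < monDeg s.1 ∧ monDeg s.1 + k < 2 * (m * k)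
    · refine ⟨monEps (g (monDeg s.1)), ?_, fun t ht hst hne => ?_⟩
      · have := h.eps_ne _ hr.1 hr.2
        rwa [← e] at this
      · rcases key t ht with ⟨_, e'⟩ | ⟨_, _, e'⟩
        · exact absurd (Subtype.ext (by rw [e, e', hst])) hne
        · rw [hst, ← e']
    · refine ⟨monEps s.1 + 1, by omega, fun t ht hst hne => ?_⟩
      rcases key t ht with ⟨_, e'⟩ | ⟨h₁, h₂, e'⟩
      · exact absurd (Subtype.ext (by rw [e, e', hst])) hne
      · omega
  · refine ⟨monEps (f (monDeg s.1)), ?_, fun t ht hst hne => ?_⟩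
    · have := (h.eps_ne _ hd hd').symm
      rwa [← e] at this
    · rcases key t ht with ⟨_, e'⟩ | ⟨_, _, e'⟩
      · rw [hst, ← e']
      · exact absurd (Subtype.ext (by rw [e, e', hst])) hne

theorem linearIndependent (h : IsDegreeEnum k m S f g) :
    LinearIndependent ℂ (fun s : S => monElem k (s : DegMon k m).1) := by
  rw [Fintype.linearIndependent_iff]
  intro a ha s
  obtain ⟨e, hne, he⟩ := h.exists_eps s.2
  have hsum := sum_eq_zero_of_degree (fun s : S => (s : DegMon k m).1) a ha
    (monDeg (s : DegMon k m).1) e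
  rw [Finset.sum_eq_single s] at hsum
  · rw [if_pos rfl] at hsum
    exact (mul_eq_zero.1 hsum).resolve_right (sub_ne_zero.2 (by exact_mod_cast hne))
  · intro t _ hts
    split_ifs with hd
    · rw [he t t.2 hd fun h => hts (Subtype.ext h)]
      simp
    · rfl
  · simp

theorem monElem_mem_span (h : IsDegreeEnum k m S f g) (σ : Multiset (Fin (2 * k + 1)))
    (hσ : Multiset.card σ = m) :
    monElem k σ ∈ Submodule.span ℂ ((fun s : DegMon k m => monElem k s.1) '' S) := by
  have hle := monDeg_le k σ
  rw [hσ] at hle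
  have hfS : monElem k (f (monDeg σ)) ∈ (fun s : DegMon k m => monElem k s.1) '' S :=
    ⟨⟨f (monDeg σ), h.card_f _ hle⟩, (h.mem_iff _).2 (Or.inl ⟨_, hle, rfl⟩), rfl⟩
  by_cases hr : k < monDeg σ ∧ monDeg σ + k < 2 * (m * k)
  · have hgS : monElem k (g (monDeg σ)) ∈ (fun s : DegMon k m => monElem k s.1) '' S :=
      ⟨⟨g (monDeg σ), h.card_g _ hr.1 hr.2⟩,
        (h.mem_iff _).2 (Or.inr ⟨_, hr.1, hr.2, rfl⟩), rfl⟩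
    exact Submodule.span_mono (Set.insert_subset hfS (Set.singleton_subset_iff.2 hgS))
      (monElem_mem_span_pair (h.deg_f _ hle) (h.deg_g _ hr.1 hr.2) (h.eps_ne _ hr.1 hr.2))
  · have hdeg := h.deg_f _ hle
    have h₁ := monEps_eq_zero_or k σ
    have h₂ := monEps_add_eq_or k σ
    have h₃ := monEps_eq_zero_or k (f (monDeg σ))
    have h₄ := monEps_add_eq_or k (f (monDeg σ))
    rw [h.card_f _ hle, hdeg] at h₄
    rw [hdeg] at h₃
    rw [hσ] at h₂
    rw [monElem_eq_of_eq hdeg.symm (by omega : monEps σ = monEps (f (monDeg σ)))]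
    exact Submodule.subset_span hfS

theorem isMonomialBasis (h : IsDegreeEnum k m S f g) : IsMonomialBasis k m S := by
  refine ⟨h.linearIndependent, le_antisymm (Submodule.span_le.2 ?_) (Submodule.span_le.2 ?_)⟩
  · rintro _ ⟨s, -, rfl⟩
    exact Submodule.subset_span ⟨s.1, s.2, rfl⟩
  · rintro _ ⟨σ, hσ, rfl⟩
    exact h.monElem_mem_span σ hσ

theorem setWeight_eq (h : IsDegreeEnum k m S f g) (ρ : Fin (2 * k + 1) → ℤ) :
    setWeight ρ S = ∑ d ∈ Finset.range (2 * (m * k) + 1), ((f d).map ρ).sum +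
      ∑ d ∈ Finset.Ico (k + 1) (2 * (m * k) - k), ((g d).map ρ).sum := by
  refine Eq.trans ?_ (Finset.sum_disjSum (Finset.range (2 * (m * k) + 1))
    (Finset.Ico (k + 1) (2 * (m * k) - k))
    (Sum.elim (fun d => ((f d).map ρ).sum) (fun d => ((g d).map ρ).sum)))
  have hT : ∀ {d}, Sum.inl d ∈ (Finset.range (2 * (m * k) + 1)).disjSum
      (Finset.Ico (k + 1) (2 * (m * k) - k)) → d ≤ 2 * (m * k) := by
    intro d hd
    rw [Finset.inl_mem_disjSum, Finset.mem_range] at hd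
    omega
  have hN : ∀ {d}, Sum.inr d ∈ (Finset.range (2 * (m * k) + 1)).disjSum
      (Finset.Ico (k + 1) (2 * (m * k) - k)) → k < d ∧ d + k < 2 * (m * k) := by
    intro d hd
    rw [Finset.inr_mem_disjSum, Finset.mem_Ico] at hd
    omega
  symm
  refine Finset.sum_bij
    (fun p hp => ⟨Sum.elim f g p, by
      rcases p with d | d
      · exact h.card_f d (hT hp)
      · exact h.card_g d (hN hp).1 (hN hp).2⟩) ?_ ?_ ?_ ?_
  · rintro (d | d) hp
    · exact (h.mem_iff _).2 (Or.inl ⟨d, hT hp, rfl⟩)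
    · exact (h.mem_iff _).2 (Or.inr ⟨d, (hN hp).1, (hN hp).2, rfl⟩)
  · rintro (d | d) hp (d' | d') hp' heq <;> replace heq := congrArg Subtype.val heq <;>
      simp only [Sum.elim_inl, Sum.elim_inr] at heq
    · have := congrArg monDeg heq
      rw [h.deg_f d (hT hp), h.deg_f d' (hT hp')] at this
      rw [this]
    · have := congrArg monDeg heq
      rw [h.deg_f d (hT hp), h.deg_g d' (hN hp').1 (hN hp').2] at this
      subst this
      exact absurd (congrArg monEps heq) (h.eps_ne d (hN hp').1 (hN hp').2)
    · have := congrArg monDeg heq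
      rw [h.deg_f d' (hT hp'), h.deg_g d (hN hp).1 (hN hp).2] at this
      subst this
      exact absurd (congrArg monEps heq.symm) (h.eps_ne d (hN hp).1 (hN hp).2)
    · have := congrArg monDeg heq
      rw [h.deg_g d (hN hp).1 (hN hp).2, h.deg_g d' (hN hp').1 (hN hp').2] at this
      rw [this]
  · intro σ hσ
    rcases (h.mem_iff σ).1 hσ with ⟨d, hd, e⟩ | ⟨d, hd, hd', e⟩
    · exact ⟨Sum.inl d, by rw [Finset.inl_mem_disjSum, Finset.mem_range]; omega,
        Subtype.ext e.symm⟩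
    · exact ⟨Sum.inr d, by rw [Finset.inr_mem_disjSum, Finset.mem_Ico]; omega,
        Subtype.ext e.symm⟩
  · rintro (d | d) hp <;> rfl

end IsDegreeEnum

/-- The monomial with one factor of index `j`, `a` factors of index `p` and `b` of index `q`. -/
def triMon (k j a p b q : ℕ) : Multiset (Fin (2 * k + 1)) :=
  ribIdx k j ::ₘ (Multiset.replicate a (ribIdx k p) + Multiset.replicate b (ribIdx k q))

theorem card_triMon (k j a p b q : ℕ) : Multiset.card (triMon k j a p b q) = a + b + 1 := by
  simp [triMon]

theorem monDeg_triMon {k j p q : ℕ} (a b : ℕ) (hj : j ≤ 2 * k) (hp : p ≤ 2 * k)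
    (hq : q ≤ 2 * k) : monDeg (triMon k j a p b q) = j + a * p + b * q := by
  simp [monDeg, triMon, ribIdx_val hj, ribIdx_val hp, ribIdx_val hq, add_assoc]

theorem monEps_triMon {k j p q : ℕ} (a b : ℕ) (hj : j ≤ 2 * k) (hp : p ≤ 2 * k)
    (hq : q ≤ 2 * k) :
    monEps (triMon k j a p b q) = (j - k) + a * (p - k) + b * (q - k) := by
  simp [monEps, triMon, ribIdx_val hj, ribIdx_val hp, ribIdx_val hq, add_assoc]

theorem weight_triMon (k j a p b q : ℕ) (ρ : Fin (2 * k + 1) → ℤ) :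
    ((triMon k j a p b q).map ρ).sum =
      ρ (ribIdx k j) + a * ρ (ribIdx k p) + b * ρ (ribIdx k q) := by
  simp [triMon, add_assoc]

theorem exists_eq_replicate_add {α : Type*} {p q : α} {τ : Multiset α}
    (h : ∀ i ∈ τ, i = p ∨ i = q) :
    ∃ a b, a + b = Multiset.card τ ∧ τ = Multiset.replicate a p + Multiset.replicate b q := by
  induction τ using Multiset.induction with
  | empty => exact ⟨0, 0, by simp, by simp⟩
  | cons i τ ih =>
    obtain ⟨a, b, hab, e⟩ := ih fun i hi => h i (Multiset.mem_cons_of_mem hi)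
    rcases h i (Multiset.mem_cons_self i τ) with rfl | rfl
    · refine ⟨a + 1, b, by rw [Multiset.card_cons]; omega, ?_⟩
      rw [Multiset.replicate_succ, Multiset.cons_add, ← e]
    · refine ⟨a, b + 1, by rw [Multiset.card_cons]; omega, ?_⟩
      rw [Multiset.replicate_succ, Multiset.add_cons, ← e]

theorem exists_val_replicate_add {k n p q : ℕ} (hp : p ≤ 2 * k) (hq : q ≤ 2 * k)
    {τ : Multiset (Fin (2 * k + 1))} (hτ : Multiset.card τ = n)
    (h : ∀ i ∈ τ, (i : ℕ) = p ∨ (i : ℕ) = q) :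
    ∃ a b, a + b = n ∧
      τ = Multiset.replicate a (ribIdx k p) + Multiset.replicate b (ribIdx k q) := by
  subst hτ
  refine exists_eq_replicate_add fun i hi => ?_
  rw [← val_eq_iff_ribIdx hp, ← val_eq_iff_ribIdx hq]
  exact h i hi

theorem val_of_mem_replicate_add {k p q a b : ℕ} (hp : p ≤ 2 * k) (hq : q ≤ 2 * k)
    (i : Fin (2 * k + 1))
    (hi : i ∈ Multiset.replicate a (ribIdx k p) + Multiset.replicate b (ribIdx k q)) :
    (i : ℕ) = p ∨ (i : ℕ) = q := by
  rw [val_eq_iff_ribIdx hp, val_eq_iff_ribIdx hq]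
  exact (Multiset.mem_add.1 hi).imp Multiset.eq_of_mem_replicate Multiset.eq_of_mem_replicate

theorem mul_add_div_mod {k s : ℕ} (q : ℕ) (hs : s < k) :
    (q * k + s) / k = q ∧ (q * k + s) % k = s := by
  rw [mul_comm]
  exact ⟨by rw [Nat.mul_add_div (by omega), Nat.div_eq_of_lt hs, add_zero],
    by rw [Nat.mul_add_mod, Nat.mod_eq_of_lt hs]⟩

theorem mul_add_lt_mul {k s q n : ℕ} (hq : q < n) (hs : s < k) : q * k + s < n * k := by
  have := Nat.mul_le_mul_right k (Nat.succ_le_of_lt hq)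
  rw [Nat.succ_mul] at this
  omega

theorem exists_eq_mul_add {k n d : ℕ} (hd : d < n * k) :
    ∃ a q s, a + q + 1 = n ∧ s < k ∧ d = q * k + s := by
  have hk : 0 < k := Nat.pos_of_ne_zero (by rintro rfl; simp at hd)
  have hq : d / k < n := Nat.div_lt_of_lt_mul (by rwa [mul_comm])
  exact ⟨n - 1 - d / k, d / k, d % k, by omega, Nat.mod_lt d hk, (Nat.div_add_mod' d k).symm⟩

theorem two_mul_sum_grid {k n : ℕ} {F t : ℕ → ℤ} {γ α : ℤ}
    (h : ∀ q < n, ∀ s < k, F (q * k + s) = γ + α * q + t s) :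
    2 * ∑ d ∈ Finset.range (n * k), F d =
      k * (2 * n * γ + n * (n - 1) * α) + 2 * n * ∑ s ∈ Finset.range k, t s := by
  induction n with
  | zero => simp
  | succ n ih =>
    rw [add_mul, one_mul, Finset.sum_range_add, mul_add, ih fun q hq => h q (by omega),
      Finset.sum_congr rfl fun s hs => h n (by omega) s (Finset.mem_range.1 hs),
      Finset.sum_add_distrib, Finset.sum_const, Finset.card_range, nsmul_eq_mul]
    push_cast
    ring

/-- The members of `B₁⁺` with the smallest `ε`-part in their degree, for degrees up to `mk`,
and with the largest one above. -/
def enumB1 (k m d : ℕ) : Multiset (Fin (2 * k + 1)) :=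
  if d < m * k then triMon k (d % k) (m - 1 - d / k) 0 (d / k) k
  else if d = m * k then Multiset.replicate m (ribIdx k k)
  else triMon k (k + 1 + (d - (m * k + 1)) % k) (m - 1 - (d - (m * k + 1)) / k) k
    ((d - (m * k + 1)) / k) (2 * k)

/-- The remaining members of `B₁⁺`. -/
def enumB1' (k m d : ℕ) : Multiset (Fin (2 * k + 1)) :=
  if d ≤ m * k then
    triMon k (k + 1 + (d - (k + 1)) % k) (m - 1 - (d - (k + 1)) / k) 0 ((d - (k + 1)) / k) k
  else triMon k ((d - m * k) % k) (m - 2 - (d - m * k) / k) k ((d - m * k) / k + 1) (2 * k)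

section B1

variable {k m a q s : ℕ}

theorem enumB1_low (h : a + q + 1 = m) (hs : s < k) :
    enumB1 k m (q * k + s) = triMon k s a 0 q k := by
  obtain ⟨h₁, h₂⟩ := mul_add_div_mod q hs
  rw [enumB1, if_pos (mul_add_lt_mul (by omega) hs), h₁, h₂, show m - 1 - q = a by omega]

theorem enumB1_mid : enumB1 k m (m * k) = Multiset.replicate m (ribIdx k k) := by
  rw [enumB1, if_neg (lt_irrefl _), if_pos rfl]

theorem enumB1_high (h : a + q + 1 = m) (hs : s < k) :
    enumB1 k m (m * k + 1 + (q * k + s)) = triMon k (k + 1 + s) a k q (2 * k) := by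
  obtain ⟨h₁, h₂⟩ := mul_add_div_mod q hs
  rw [enumB1, if_neg (by omega), if_neg (by omega), Nat.add_sub_cancel_left, h₁, h₂,
    show m - 1 - q = a by omega]

theorem enumB1'_low (h : a + q + 2 = m) (hs : s < k) :
    enumB1' k m (k + 1 + (q * k + s)) = triMon k (k + 1 + s) (a + 1) 0 q k := by
  obtain ⟨h₁, h₂⟩ := mul_add_div_mod q hs
  have := mul_add_lt_mul (show q + 1 < m by omega) hs
  rw [add_mul] at this
  rw [enumB1', if_pos (by omega), Nat.add_sub_cancel_left, h₁, h₂,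
    show m - 1 - q = a + 1 by omega]

theorem enumB1'_high (h : a + q + 2 = m) (hs : s < k) (h0 : 0 < q * k + s) :
    enumB1' k m (m * k + (q * k + s)) = triMon k s a k (q + 1) (2 * k) := by
  obtain ⟨h₁, h₂⟩ := mul_add_div_mod q hs
  rw [enumB1', if_neg (by omega), Nat.add_sub_cancel_left, h₁, h₂,
    show m - 2 - q = a by omega]

theorem enumB1_cases {d : ℕ} (hd : d ≤ 2 * (m * k)) :
    (∃ a q s, a + q + 1 = m ∧ s < k ∧ d = q * k + s) ∨ d = m * k ∨
      ∃ a q s, a + q + 1 = m ∧ s < k ∧ d = m * k + 1 + (q * k + s) := by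
  rcases lt_trichotomy d (m * k) with h | h | h
  · exact Or.inl (exists_eq_mul_add h)
  · exact Or.inr (Or.inl h)
  · obtain ⟨a, q, s, h₁, h₂, h₃⟩ := exists_eq_mul_add (show d - (m * k + 1) < m * k by omega)
    exact Or.inr (Or.inr ⟨a, q, s, h₁, h₂, by omega⟩)

theorem enumB1'_cases {d : ℕ} (hm : 1 ≤ m) (hd : k < d) (hd' : d + k < 2 * (m * k)) :
    (∃ a q s, a + q + 2 = m ∧ s < k ∧ d = k + 1 + (q * k + s)) ∨
      ∃ a q s, a + q + 2 = m ∧ s < k ∧ 0 < q * k + s ∧ d = m * k + (q * k + s) := by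
  obtain ⟨n, rfl⟩ : ∃ n, m = n + 1 := ⟨m - 1, by omega⟩
  rw [add_mul, one_mul] at hd' ⊢
  by_cases h : d ≤ n * k + k
  · obtain ⟨a, q, s, h₁, h₂, h₃⟩ := exists_eq_mul_add (show d - (k + 1) < n * k by omega)
    exact Or.inl ⟨a, q, s, by omega, h₂, by omega⟩
  · obtain ⟨a, q, s, h₁, h₂, h₃⟩ := exists_eq_mul_add (show d - (n * k + k) < n * k by omega)
    exact Or.inr ⟨a, q, s, by omega, h₂, by omega, by omega⟩

theorem monEps_enumB1 {d : ℕ} (hd : d ≤ 2 * (m * k)) :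
    monEps (enumB1 k m d) = d - m * k := by
  rcases enumB1_cases hd with ⟨a, q, s, h, hs, rfl⟩ | rfl | ⟨a, q, s, h, hs, rfl⟩
  · have := mul_add_lt_mul (show q < m by omega) hs
    rw [enumB1_low h hs, monEps_triMon _ _ (by omega) (by omega) (by omega)]
    simp only [Nat.zero_sub, Nat.sub_self, mul_zero, add_zero]
    omega
  · rw [enumB1_mid]
    simp [monEps, ribIdx_val (show k ≤ 2 * k by omega)]
  · rw [enumB1_high h hs, monEps_triMon _ _ (by omega) (by omega) (by omega),
      show 2 * k - k = k by omega, Nat.sub_self, mul_zero]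
    omega

end B1

theorem isDegreeEnum_B1 {k m : ℕ} (hk : 1 ≤ k) (hm : 3 ≤ m) :
    IsDegreeEnum k m (Finset.univ.filter (memB1 k m)) (enumB1 k m) (enumB1' k m) where
  card_f d hd := by
    rcases enumB1_cases hd with ⟨a, q, s, h, hs, rfl⟩ | rfl | ⟨a, q, s, h, hs, rfl⟩
    · rw [enumB1_low h hs, card_triMon, h]
    · rw [enumB1_mid, Multiset.card_replicate]
    · rw [enumB1_high h hs, card_triMon, h]
  deg_f d hd := by
    rcases enumB1_cases hd with ⟨a, q, s, h, hs, rfl⟩ | rfl | ⟨a, q, s, h, hs, rfl⟩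
    · rw [enumB1_low h hs, monDeg_triMon _ _ (by omega) (by omega) (by omega)]
      ring
    · rw [enumB1_mid]
      simp [monDeg, ribIdx_val (show k ≤ 2 * k by omega)]
    · rw [enumB1_high h hs, monDeg_triMon _ _ (by omega) (by omega) (by omega), ← h]
      ring
  card_g d hd hd' := by
    rcases enumB1'_cases (by omega) hd hd' with ⟨a, q, s, h, hs, rfl⟩ | ⟨a, q, s, h, hs, h0, rfl⟩
    · rw [enumB1'_low h hs, card_triMon]
      omega
    · rw [enumB1'_high h hs h0, card_triMon]
      omega
  deg_g d hd hd' := by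
    rcases enumB1'_cases (by omega) hd hd' with ⟨a, q, s, h, hs, rfl⟩ | ⟨a, q, s, h, hs, h0, rfl⟩
    · rw [enumB1'_low h hs, monDeg_triMon _ _ (by omega) (by omega) (by omega)]
      ring
    · rw [enumB1'_high h hs h0, monDeg_triMon _ _ (by omega) (by omega) (by omega), ← h]
      ring
  eps_ne d hd hd' := by
    rw [monEps_enumB1 (by omega)]
    rcases enumB1'_cases (by omega) hd hd' with ⟨a, q, s, h, hs, rfl⟩ | ⟨a, q, s, h, hs, h0, rfl⟩
    · have := mul_add_lt_mul (show q + 1 < m by omega) hs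
      rw [add_mul] at this
      rw [enumB1'_low h hs, monEps_triMon _ _ (by omega) (by omega) (by omega)]
      omega
    · rw [enumB1'_high h hs h0, monEps_triMon _ _ (by omega) (by omega) (by omega),
        show 2 * k - k = k by omega, Nat.sub_self, mul_zero, add_mul]
      omega
  mem_iff σ := by
    have h2k : k ≤ 2 * k := by omega
    rw [Finset.mem_filter, and_iff_right (Finset.mem_univ σ)]
    constructor
    · rintro (⟨j, hj, τ, hτ, hmem, e⟩ | ⟨j, hj, τ, hτ, hmem, e⟩ | hmem)
      · obtain ⟨a, b, hab, rfl⟩ := exists_val_replicate_add (Nat.zero_le _) h2k hτ hmem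
        rw [← ribIdx_coe j] at e
        rcases lt_or_gt_of_ne hj with hlt | hgt
        · have := mul_add_lt_mul (show b < m by omega) hlt
          exact Or.inl ⟨b * k + j, by omega, by
            rw [e, enumB1_low (a := a) (by omega) hlt, triMon]⟩
        · have hs : (j : ℕ) - (k + 1) < k := by omega
          have hj' : k + 1 + ((j : ℕ) - (k + 1)) = j := by omega
          rcases Nat.eq_zero_or_pos a with rfl | ha
          · have := mul_add_lt_mul (show 0 < m by omega) hs
            refine Or.inl ⟨m * k + 1 + (0 * k + ((j : ℕ) - (k + 1))), by omega, ?_⟩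
            rw [e, enumB1_high (a := b) (by omega) hs, hj', triMon]
            simp
          · have := mul_add_lt_mul (show b + 1 < m by omega) hs
            have h3 := Nat.mul_le_mul_right k hm
            rw [add_mul] at this
            refine Or.inr ⟨k + 1 + (b * k + ((j : ℕ) - (k + 1))), by omega, by omega, ?_⟩
            rw [e, enumB1'_low (a := a - 1) (by omega) hs, hj', triMon, Nat.sub_add_cancel ha]
      · obtain ⟨a, b, hab, rfl⟩ := exists_val_replicate_add h2k le_rfl hτ hmem
        rw [← ribIdx_coe j] at e
        rcases lt_or_gt_of_ne hj with hlt | hgt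
        · rcases Nat.eq_zero_or_pos b with rfl | hb
          · have := mul_add_lt_mul (show a < m by omega) hlt
            refine Or.inl ⟨a * k + j, by omega, ?_⟩
            rw [e, enumB1_low (a := 0) (by omega) hlt, triMon]
            simp
          · obtain ⟨c, rfl⟩ : ∃ c, b = c + 1 := ⟨b - 1, by omega⟩
            have := mul_add_lt_mul (show c + 1 < m by omega) hlt
            rw [add_mul] at this
            rcases Nat.eq_zero_or_pos (c * k + j) with h0 | h0
            · have hj0 : (j : ℕ) = 0 := by omega
              have hc0 : c = 0 := by
                rcases Nat.mul_eq_zero.1 (show c * k = 0 by omega) with h | h <;> omega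
              subst hc0
              have h3 := Nat.mul_le_mul_right k hm
              have h4 := mul_add_lt_mul (show a + 1 < m by omega) (show k - 1 < k by omega)
              rw [add_mul] at h4
              refine Or.inr ⟨k + 1 + (a * k + (k - 1)), by omega, by omega, ?_⟩
              rw [e, enumB1'_low (a := 0) (by omega) (by omega), triMon, hj0,
                show k + 1 + (k - 1) = 2 * k by omega]
              simp only [zero_add, Multiset.replicate_one, ← Multiset.singleton_add]
              abel
            · refine Or.inr ⟨m * k + (c * k + j), ?_, ?_, ?_⟩
              · have h3 := Nat.mul_le_mul_right k hm
                omega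
              · omega
              · rw [e, enumB1'_high (a := a) (by omega) hlt h0, triMon]
        · have hs : (j : ℕ) - (k + 1) < k := by omega
          have hj' : k + 1 + ((j : ℕ) - (k + 1)) = j := by omega
          have := mul_add_lt_mul (show b < m by omega) hs
          refine Or.inl ⟨m * k + 1 + (b * k + ((j : ℕ) - (k + 1))), by omega, ?_⟩
          rw [e, enumB1_high (a := a) (by omega) hs, hj', triMon]
      · refine Or.inl ⟨m * k, by omega, ?_⟩
        rw [enumB1_mid, Multiset.eq_replicate]
        exact ⟨σ.2, fun i hi => (val_eq_iff_ribIdx h2k i).1 (hmem i hi)⟩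
    · rintro (⟨d, hd, e⟩ | ⟨d, hd, hd', e⟩)
      · rcases enumB1_cases hd with ⟨a, q, s, h, hs, rfl⟩ | rfl | ⟨a, q, s, h, hs, rfl⟩
        · rw [enumB1_low h hs] at e
          exact Or.inl ⟨ribIdx k s, by rw [ribIdx_val] <;> omega, _, by simp; omega,
            val_of_mem_replicate_add (Nat.zero_le _) h2k, e⟩
        · rw [enumB1_mid] at e
          refine Or.inr (Or.inr fun i hi => ?_)
          rw [e] at hi
          exact (val_eq_iff_ribIdx h2k i).2 (Multiset.eq_of_mem_replicate hi)
        · rw [enumB1_high h hs] at e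
          exact Or.inr (Or.inl ⟨ribIdx k (k + 1 + s), by rw [ribIdx_val] <;> omega, _,
            by simp; omega, val_of_mem_replicate_add h2k le_rfl, e⟩)
      · rcases enumB1'_cases (by omega) hd hd' with
          ⟨a, q, s, h, hs, rfl⟩ | ⟨a, q, s, h, hs, h0, rfl⟩
        · rw [enumB1'_low h hs] at e
          exact Or.inl ⟨ribIdx k (k + 1 + s), by rw [ribIdx_val] <;> omega, _, by simp; omega,
            val_of_mem_replicate_add (Nat.zero_le _) h2k, e⟩
        · rw [enumB1'_high h hs h0] at e
          exact Or.inr (Or.inl ⟨ribIdx k s, by rw [ribIdx_val] <;> omega, _,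
            by simp; omega, val_of_mem_replicate_add h2k le_rfl, e⟩)

/-- The members of `B₂⁺` with the larger `ε`-part in their degree. -/
def enumB2 (k m d : ℕ) : Multiset (Fin (2 * k + 1)) :=
  if d < m * (2 * k) then
    triMon k (d % (2 * k)) (m - 1 - d / (2 * k)) 0 (d / (2 * k)) (2 * k)
  else Multiset.replicate m (ribIdx k (2 * k))

/-- The members of `B₂⁺` with the smaller `ε`-part in their degree. -/
def enumB2' (k m d : ℕ) : Multiset (Fin (2 * k + 1)) :=
  if (d - k) % (2 * k) = 0 then
    ribIdx k k ::ₘ ribIdx k k ::ₘ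
      triMon k k (m - 2 - (d - k) / (2 * k)) 0 ((d - k) / (2 * k) - 1) (2 * k)
  else ribIdx k k ::ₘ
    triMon k ((d - k) % (2 * k)) (m - 2 - (d - k) / (2 * k)) 0 ((d - k) / (2 * k)) (2 * k)

section B2

variable {k m a q s : ℕ}

theorem enumB2_low (h : a + q + 1 = m) (hs : s < 2 * k) :
    enumB2 k m (q * (2 * k) + s) = triMon k s a 0 q (2 * k) := by
  obtain ⟨h₁, h₂⟩ := mul_add_div_mod q hs
  rw [enumB2, if_pos (mul_add_lt_mul (by omega) hs), h₁, h₂, show m - 1 - q = a by omega]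

theorem enumB2_top : enumB2 k m (m * (2 * k)) = Multiset.replicate m (ribIdx k (2 * k)) := by
  rw [enumB2, if_neg (lt_irrefl _)]

theorem enumB2'_zero (hk : 1 ≤ k) (h : a + q + 3 = m) :
    enumB2' k m (k + (q + 1) * (2 * k)) =
      ribIdx k k ::ₘ ribIdx k k ::ₘ triMon k k a 0 q (2 * k) := by
  obtain ⟨h₁, h₂⟩ := mul_add_div_mod (q + 1) (show 0 < 2 * k by omega)
  rw [add_zero] at h₁ h₂
  rw [enumB2', Nat.add_sub_cancel_left, h₁, h₂, if_pos rfl, show m - 2 - (q + 1) = a by omega,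
    Nat.add_sub_cancel]

theorem enumB2'_pos (h : a + q + 2 = m) (hs : s < 2 * k) (h0 : 0 < s) :
    enumB2' k m (k + (q * (2 * k) + s)) = ribIdx k k ::ₘ triMon k s a 0 q (2 * k) := by
  obtain ⟨h₁, h₂⟩ := mul_add_div_mod q hs
  rw [enumB2', Nat.add_sub_cancel_left, h₁, h₂, if_neg (by omega),
    show m - 2 - q = a by omega]

theorem enumB2_cases {d : ℕ} (hd : d ≤ 2 * (m * k)) :
    (∃ a q s, a + q + 1 = m ∧ s < 2 * k ∧ d = q * (2 * k) + s) ∨ d = m * (2 * k) := by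
  rw [← mul_left_comm] at hd
  rcases lt_or_eq_of_le hd with h | h
  · exact Or.inl (exists_eq_mul_add h)
  · exact Or.inr h

theorem enumB2'_cases {d : ℕ} (hm : 1 ≤ m) (hd : k < d) (hd' : d + k < 2 * (m * k)) :
    (∃ a q, a + q + 3 = m ∧ d = k + (q + 1) * (2 * k)) ∨
      ∃ a q s, a + q + 2 = m ∧ s < 2 * k ∧ 0 < s ∧ d = k + (q * (2 * k) + s) := by
  obtain ⟨n, rfl⟩ : ∃ n, m = n + 1 := ⟨m - 1, by omega⟩
  rw [← mul_left_comm, add_mul, one_mul] at hd'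
  obtain ⟨a, q, s, h₁, h₂, h₃⟩ := exists_eq_mul_add (show d - k < n * (2 * k) by omega)
  rcases Nat.eq_zero_or_pos s with rfl | h0
  · rcases q with _ | q
    · omega
    · exact Or.inl ⟨a, q, by omega, by omega⟩
  · exact Or.inr ⟨a, q, s, by omega, h₂, h0, by omega⟩

theorem monDeg_cons_ribIdx (σ : Multiset (Fin (2 * k + 1))) :
    monDeg (ribIdx k k ::ₘ σ) = k + monDeg σ := by
  simp [monDeg, ribIdx_val (show k ≤ 2 * k by omega)]

theorem monEps_cons_ribIdx (σ : Multiset (Fin (2 * k + 1))) :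
    monEps (ribIdx k k ::ₘ σ) = monEps σ := by
  simp [monEps, ribIdx_val (show k ≤ 2 * k by omega)]

end B2

theorem isDegreeEnum_B2 {k m : ℕ} (hk : 1 ≤ k) (hm : 3 ≤ m) :
    IsDegreeEnum k m (Finset.univ.filter (memB2 k m)) (enumB2 k m) (enumB2' k m) where
  card_f d hd := by
    rcases enumB2_cases hd with ⟨a, q, s, h, hs, rfl⟩ | rfl
    · rw [enumB2_low h hs, card_triMon, h]
    · rw [enumB2_top, Multiset.card_replicate]
  deg_f d hd := by
    rcases enumB2_cases hd with ⟨a, q, s, h, hs, rfl⟩ | rfl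
    · rw [enumB2_low h hs, monDeg_triMon _ _ (by omega) (by omega) (by omega)]
      ring
    · rw [enumB2_top]
      simp [monDeg, ribIdx_val (le_refl (2 * k))]
  card_g d hd hd' := by
    rcases enumB2'_cases (by omega) hd hd' with ⟨a, q, h, rfl⟩ | ⟨a, q, s, h, hs, h0, rfl⟩
    · rw [enumB2'_zero hk h, Multiset.card_cons, Multiset.card_cons, card_triMon]
      omega
    · rw [enumB2'_pos h hs h0, Multiset.card_cons, card_triMon]
      omega
  deg_g d hd hd' := by
    rcases enumB2'_cases (by omega) hd hd' with ⟨a, q, h, rfl⟩ | ⟨a, q, s, h, hs, h0, rfl⟩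
    · rw [enumB2'_zero hk h, monDeg_cons_ribIdx, monDeg_cons_ribIdx,
        monDeg_triMon _ _ (by omega) (by omega) (by omega)]
      ring
    · rw [enumB2'_pos h hs h0, monDeg_cons_ribIdx,
        monDeg_triMon _ _ (by omega) (by omega) (by omega)]
      ring
  eps_ne d hd hd' := by
    have hf : d ≤ 2 * monEps (enumB2 k m d) + k := by
      rcases enumB2_cases (m := m) (k := k) (d := d) (by omega) with
        ⟨a, q, s, h, hs, rfl⟩ | rfl
      · rw [enumB2_low h hs, monEps_triMon _ _ (by omega) (by omega) (by omega), Nat.zero_sub,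
          mul_zero, show 2 * k - k = k by omega, mul_left_comm]
        omega
      · rw [mul_left_comm] at hd'
        omega
    have hg : 2 * monEps (enumB2' k m d) + k < d := by
      rcases enumB2'_cases (by omega) hd hd' with ⟨a, q, h, rfl⟩ | ⟨a, q, s, h, hs, h0, rfl⟩
      · rw [enumB2'_zero hk h, monEps_cons_ribIdx, monEps_cons_ribIdx,
          monEps_triMon _ _ (by omega) (by omega) (by omega), Nat.zero_sub,
          mul_zero, show 2 * k - k = k by omega, mul_left_comm, add_mul]
        omega
      · rw [enumB2'_pos h hs h0, monEps_cons_ribIdx,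
          monEps_triMon _ _ (by omega) (by omega) (by omega), Nat.zero_sub,
          mul_zero, show 2 * k - k = k by omega, mul_left_comm]
        omega
    omega
  mem_iff σ := by
    have h2k : k ≤ 2 * k := by omega
    have hlt : ∀ {b n s : ℕ}, b < n → s < 2 * k → b * (2 * k) + s < 2 * (n * k) := by
      intro b n s hb hs
      have := mul_add_lt_mul hb hs
      rwa [mul_left_comm n] at this
    have hmk : 2 * (m * k) = 2 * ((m - 1) * k) + 2 * k := by
      obtain ⟨n, rfl⟩ : ∃ n, m = n + 1 := ⟨m - 1, by omega⟩
      rw [Nat.add_sub_cancel]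
      ring
    rw [Finset.mem_filter, and_iff_right (Finset.mem_univ σ)]
    simp only [memB2, mk_eq_ribIdx]
    constructor
    · rintro (⟨j, ⟨hj0, hjk, hj2⟩, τ, hτ, hmem, e⟩ | ⟨j, ⟨hj0, hjk, hj2⟩, τ, hτ, hmem, e⟩ | hmem |
        ⟨r, hr, τ, hτ, hmem, e⟩)
      · obtain ⟨a, b, hab, rfl⟩ := exists_val_replicate_add (Nat.zero_le _) le_rfl hτ hmem
        rw [← ribIdx_coe j] at e
        have hj : (j : ℕ) < 2 * k := by omega
        have := hlt (show b < m by omega) hj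
        exact Or.inl ⟨b * (2 * k) + j, by omega, by
          rw [e, enumB2_low (a := a) (by omega) hj, triMon]⟩
      · obtain ⟨a, b, hab, rfl⟩ := exists_val_replicate_add (Nat.zero_le _) le_rfl hτ hmem
        rw [← ribIdx_coe j] at e
        have hj : (j : ℕ) < 2 * k := by omega
        have := hlt (show b < m - 1 by omega) hj
        exact Or.inr ⟨k + (b * (2 * k) + j), by omega, by omega, by
          rw [e, enumB2'_pos (a := a) (by omega) hj (by omega), triMon, Multiset.cons_swap]⟩
      · obtain ⟨a, b, hab, e⟩ := exists_val_replicate_add (Nat.zero_le _) le_rfl σ.2 hmem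
        rcases a with _ | a
        · refine Or.inl ⟨m * (2 * k), by rw [mul_left_comm], ?_⟩
          rw [enumB2_top]
          exact e.trans (by rw [Multiset.replicate_zero, zero_add, show b = m by omega])
        · have := hlt (show b < m by omega) (show 0 < 2 * k by omega)
          refine Or.inl ⟨b * (2 * k) + 0, by omega, ?_⟩
          rw [enumB2_low (a := a) (by omega) (by omega), triMon]
          refine e.trans ?_
          rw [Multiset.replicate_succ, Multiset.cons_add]
      · obtain ⟨a, b, hab, rfl⟩ := exists_val_replicate_add (Nat.zero_le _) le_rfl hτ hmem
        rcases hr with rfl | rfl | rfl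
        · have := hlt (show b < m by omega) (show k < 2 * k by omega)
          refine Or.inl ⟨b * (2 * k) + k, by omega, ?_⟩
          rw [e, enumB2_low (a := a) (by omega) (by omega), triMon]
          rfl
        · have := hlt (show b < m - 1 by omega) (show k < 2 * k by omega)
          refine Or.inr ⟨k + (b * (2 * k) + k), by omega, by omega, ?_⟩
          rw [e, enumB2'_pos (a := a) (by omega) (by omega) (by omega), triMon]
          simp [Multiset.replicate_succ, Multiset.cons_add]
        · have := hlt (show b + 1 < m - 1 by omega) (show 0 < 2 * k by omega)
          refine Or.inr ⟨k + (b + 1) * (2 * k), ?_, by omega, ?_⟩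
          · have := Nat.mul_le_mul_right (2 * k) (Nat.le_add_left 1 b)
            omega
          rw [e, enumB2'_zero hk (a := a) (by omega), triMon]
          simp [Multiset.replicate_succ, Multiset.cons_add]
    · rintro (⟨d, hd, e⟩ | ⟨d, hd, hd', e⟩)
      · rcases enumB2_cases hd with ⟨a, q, s, h, hs, rfl⟩ | rfl
        · rw [enumB2_low h hs] at e
          by_cases hs0 : s = 0
          · subst hs0
            refine Or.inr (Or.inr (Or.inl fun i hi => ?_))
            refine val_of_mem_replicate_add (a := a + 1) (b := q) (Nat.zero_le _) le_rfl i ?_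
            rw [Multiset.replicate_succ, Multiset.cons_add]
            rw [e] at hi
            exact hi
          by_cases hsk : s = k
          · subst hsk
            exact Or.inr (Or.inr (Or.inr ⟨1, Or.inl rfl, _, by simp; omega,
              val_of_mem_replicate_add (Nat.zero_le _) le_rfl, e⟩))
          · exact Or.inl ⟨ribIdx k s, by rw [ribIdx_val (by omega)]; omega, _, by simp; omega,
              val_of_mem_replicate_add (Nat.zero_le _) le_rfl, e⟩
        · rw [enumB2_top] at e
          refine Or.inr (Or.inr (Or.inl fun i hi => Or.inr ?_))
          rw [e] at hi
          exact (val_eq_iff_ribIdx le_rfl i).2 (Multiset.eq_of_mem_replicate hi)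
      · rcases enumB2'_cases (by omega) hd hd' with ⟨a, q, h, rfl⟩ | ⟨a, q, s, h, hs, h0, rfl⟩
        · rw [enumB2'_zero hk h, triMon] at e
          refine Or.inr (Or.inr (Or.inr ⟨3, by simp, _, ?_,
            val_of_mem_replicate_add (a := a) (b := q) (Nat.zero_le _) le_rfl, ?_⟩))
          · simp; omega
          · rw [e]
            simp [Multiset.replicate_succ, Multiset.cons_add]
        · rw [enumB2'_pos h hs h0, triMon] at e
          by_cases hsk : s = k
          · subst hsk
            refine Or.inr (Or.inr (Or.inr ⟨2, by simp, _, ?_,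
              val_of_mem_replicate_add (a := a) (b := q) (Nat.zero_le _) le_rfl, ?_⟩))
            · simp; omega
            · rw [e]
              simp [Multiset.replicate_succ, Multiset.cons_add]
          · rw [Multiset.cons_swap] at e
            exact Or.inr (Or.inl ⟨ribIdx k s, by rw [ribIdx_val (by omega)]; omega, _,
              by simp; omega, val_of_mem_replicate_add (Nat.zero_le _) le_rfl, e⟩)

theorem sum_range_ribIdx {k : ℕ} (ρ : Fin (2 * k + 1) → ℤ) :
    ∑ j ∈ Finset.range (2 * k + 1), ρ (ribIdx k j) = ∑ i, ρ i := by
  rw [Finset.sum_range]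
  exact Finset.sum_congr rfl fun i _ => by rw [ribIdx_coe]

theorem setWeight_B1 {k m : ℕ} (hk : 1 ≤ k) (hm : 3 ≤ m) (ρ : Fin (2 * k + 1) → ℤ)
    (hρ : ∑ i, ρ i = 0) :
    setWeight ρ (Finset.univ.filter (memB1 k m)) =
      (((m : ℤ) - 1) ^ 2 * (2 * k) - (2 * m - 3)) * ρ (ribIdx k k) +
        ((m : ℤ) * ((m : ℤ) - 1) * k - 1) * (ρ (ribIdx k 0) + ρ (ribIdx k (2 * k))) := by
  rw [(isDegreeEnum_B1 hk hm).setWeight_eq]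
  obtain ⟨n, rfl⟩ : ∃ n, m = n + 1 := ⟨m - 1, by omega⟩
  have hnk : 0 < n * k := Nat.mul_pos (by omega) hk
  obtain ⟨M, hM⟩ : ∃ M, n * k = M + 1 := ⟨n * k - 1, by omega⟩
  rw [show 2 * ((n + 1) * k) + 1 = (n + 1) * k + 1 + (n + 1) * k by ring, Finset.sum_range_add,
    Finset.sum_range_succ, Finset.sum_Ico_eq_sum_range,
    show 2 * ((n + 1) * k) - k - (k + 1) = n * k + M by rw [add_mul, one_mul]; omega,
    Finset.sum_range_add]
  have h₁ := two_mul_sum_grid (k := k) (n := n + 1)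
    (F := fun d => ((enumB1 k (n + 1) d).map ρ).sum) (t := fun s => ρ (ribIdx k s))
    (γ := n * ρ (ribIdx k 0)) (α := ρ (ribIdx k k) - ρ (ribIdx k 0)) (by
      intro q hq s hs
      rw [enumB1_low (a := n - q) (by omega) hs, weight_triMon, Nat.cast_sub (by omega)]
      ring)
  have h₂ : ((enumB1 k (n + 1) ((n + 1) * k)).map ρ).sum = (n + 1) * ρ (ribIdx k k) := by
    rw [enumB1_mid, Multiset.map_replicate, Multiset.sum_replicate, nsmul_eq_mul]
    push_cast
    rfl
  have h₃ := two_mul_sum_grid (k := k) (n := n + 1)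
    (F := fun d => ((enumB1 k (n + 1) ((n + 1) * k + 1 + d)).map ρ).sum)
    (t := fun s => ρ (ribIdx k (k + 1 + s)))
    (γ := n * ρ (ribIdx k k)) (α := ρ (ribIdx k (2 * k)) - ρ (ribIdx k k)) (by
      intro q hq s hs
      rw [enumB1_high (a := n - q) (by omega) hs, weight_triMon, Nat.cast_sub (by omega)]
      ring)
  have h₄ := two_mul_sum_grid (k := k) (n := n)
    (F := fun d => ((enumB1' k (n + 1) (k + 1 + d)).map ρ).sum)
    (t := fun s => ρ (ribIdx k (k + 1 + s)))
    (γ := n * ρ (ribIdx k 0)) (α := ρ (ribIdx k k) - ρ (ribIdx k 0)) (by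
      intro q hq s hs
      rw [enumB1'_low (a := n - 1 - q) (by omega) hs, weight_triMon,
        show n - 1 - q + 1 = n - q by omega, Nat.cast_sub (by omega)]
      ring)
  have h₅ := two_mul_sum_grid (k := k) (n := n)
    (F := fun d => ((triMon k (d % k) (n - 1 - d / k) k (d / k + 1) (2 * k)).map ρ).sum)
    (t := fun s => ρ (ribIdx k s))
    (γ := (n - 1) * ρ (ribIdx k k) + ρ (ribIdx k (2 * k)))
    (α := ρ (ribIdx k (2 * k)) - ρ (ribIdx k k)) (by
      intro q hq s hs
      obtain ⟨e₁, e₂⟩ := mul_add_div_mod q hs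
      rw [e₁, e₂, weight_triMon, Nat.sub_sub, Nat.cast_sub (by omega)]
      push_cast
      ring)
  rw [hM, Finset.sum_range_succ', weight_triMon, Nat.zero_mod, Nat.zero_div,
    Nat.sub_zero, Nat.cast_sub (by omega)] at h₅
  have h₆ : ∑ d ∈ Finset.range M, ((enumB1' k (n + 1) (k + 1 + (n * k + d))).map ρ).sum =
      ∑ d ∈ Finset.range M,
        ((triMon k ((d + 1) % k) (n - 1 - (d + 1) / k) k ((d + 1) / k + 1) (2 * k)).map ρ).sum := by
    refine Finset.sum_congr rfl fun d _ => ?_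
    rw [show k + 1 + (n * k + d) = (n + 1) * k + (d + 1) by ring, enumB1', if_neg (by omega),
      Nat.add_sub_cancel_left]
    rfl
  rw [h₂, h₆]
  rw [← sum_range_ribIdx, show 2 * k + 1 = k + 1 + k by ring, Finset.sum_range_add,
    Finset.sum_range_succ] at hρ
  push_cast at h₁ h₃ h₅ ⊢
  refine mul_left_cancel₀ (two_ne_zero (α := ℤ)) ?_
  linear_combination h₁ + h₃ + h₄ + h₅ + (2 * (n + 1) + 2 * n) * hρ

theorem setWeight_B2 {k m : ℕ} (hk : 1 ≤ k) (hm : 3 ≤ m) (ρ : Fin (2 * k + 1) → ℤ)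
    (hρ : ∑ i, ρ i = 0) :
    setWeight ρ (Finset.univ.filter (memB2 k m)) =
      (((m : ℤ) - 1) * (2 * k) + (2 * m - 5)) * ρ (ribIdx k k) +
        (((m : ℤ) - 1) ^ 2 * (2 * k) - (2 * m - 3)) *
          (ρ (ribIdx k 0) + ρ (ribIdx k (2 * k))) := by
  rw [(isDegreeEnum_B2 hk hm).setWeight_eq]
  obtain ⟨n, rfl⟩ : ∃ n, m = n + 1 := ⟨m - 1, by omega⟩
  have hnk : 0 < n * (2 * k) := Nat.mul_pos (by omega) (by omega)
  obtain ⟨M, hM⟩ : ∃ M, n * (2 * k) = M + 1 := ⟨n * (2 * k) - 1, by omega⟩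
  obtain ⟨l, hl⟩ : ∃ l, 2 * k = l + 1 := ⟨2 * k - 1, by omega⟩
  rw [← mul_left_comm, Finset.sum_range_succ, Finset.sum_Ico_eq_sum_range,
    show (n + 1) * (2 * k) - k - (k + 1) = M by rw [add_mul, one_mul]; omega, enumB2_top]
  have hsplit : ∀ F : ℕ → ℤ, ∑ s ∈ Finset.range (2 * k), F s =
      ∑ s ∈ Finset.range l, F (s + 1) + F 0 := fun F => by rw [hl, Finset.sum_range_succ']
  set w : ℕ → ℤ := fun s => ρ (ribIdx k s) with hw
  have h₁ := two_mul_sum_grid (k := 2 * k) (n := n + 1)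
    (F := fun d => ((enumB2 k (n + 1) d).map ρ).sum) (t := w)
    (γ := n * w 0) (α := w (2 * k) - w 0) (by
      intro q hq s hs
      rw [enumB2_low (a := n - q) (by omega) hs, weight_triMon, Nat.cast_sub (by omega)]
      simp only [hw]
      ring)
  have h₂ := two_mul_sum_grid (k := 2 * k) (n := n)
    (F := fun d => if d = 0 then (n - 1) * w 0 + 3 * w k - w (2 * k) else
      ((enumB2' k (n + 1) (k + d)).map ρ).sum)
    (t := fun s => if s = 0 then 2 * w k - w (2 * k) else w s)
    (γ := (n - 1) * w 0 + w k) (α := w (2 * k) - w 0) (by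
      intro q hq s hs
      rcases Nat.eq_zero_or_pos s with rfl | h0
      · rcases q with _ | q
        · simp only [zero_mul, add_zero, if_true, Nat.cast_zero]
          ring
        · have : (q + 1) * (2 * k) ≠ 0 := Nat.mul_ne_zero (by omega) (by omega)
          simp only [add_zero, if_neg this, if_true]
          rw [enumB2'_zero hk (a := n - (q + 2)) (by omega), Multiset.map_cons,
            Multiset.map_cons, Multiset.sum_cons, Multiset.sum_cons, weight_triMon,
            Nat.cast_sub (by omega)]
          simp only [hw]
          push_cast
          ring
      · simp only [if_neg (show q * (2 * k) + s ≠ 0 by omega), if_neg (show s ≠ 0 by omega)]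
        rw [enumB2'_pos (a := n - (q + 1)) (by omega) hs h0, Multiset.map_cons,
          Multiset.sum_cons, weight_triMon, Nat.cast_sub (by omega)]
        simp only [hw]
        push_cast
        ring)
  rw [hM, Finset.sum_range_succ', hsplit] at h₂
  simp only [Nat.add_one_ne_zero, if_false, if_true] at h₂
  have h₃ : ∑ d ∈ Finset.range M, ((enumB2' k (n + 1) (k + 1 + d)).map ρ).sum =
      ∑ d ∈ Finset.range M, ((enumB2' k (n + 1) (k + (d + 1))).map ρ).sum :=
    Finset.sum_congr rfl fun d _ => by rw [add_assoc k, add_comm 1 d]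
  have hw0 : ∑ s ∈ Finset.range (2 * k), w s = - w (2 * k) := by
    rw [← sum_range_ribIdx, Finset.sum_range_succ] at hρ
    exact eq_neg_of_add_eq_zero_left hρ
  have hw1 : ∑ s ∈ Finset.range l, w (s + 1) = - w (2 * k) - w 0 := by
    rw [hsplit] at hw0
    linarith
  rw [h₃, Multiset.map_replicate, Multiset.sum_replicate, nsmul_eq_mul]
  rw [hw0] at h₁
  rw [hw1] at h₂
  change _ = _ * w k + _ * (w 0 + w (2 * k))
  change _ + _ * w (2 * k) + _ = _
  push_cast at h₁ h₂ ⊢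
  refine mul_left_cancel₀ (two_ne_zero (α := ℤ)) ?_
  linear_combination h₁ + h₂

/-- Lemma 4.5. -/
theorem ribbon_B_plus_bases (k m : ℕ) (hk : 1 ≤ k) (hm : 3 ≤ m) :
    IsMonomialBasis k m (Finset.univ.filter (memB1 k m)) ∧
    IsMonomialBasis k m (Finset.univ.filter (memB2 k m)) ∧
    ∀ ρ : Fin (2 * k + 1) → ℤ, (∑ i, ρ i) = 0 →
      setWeight ρ (Finset.univ.filter (memB1 k m)) =
          (((m : ℤ) - 1) ^ 2 * (2 * k) - (2 * m - 3)) * ρ ⟨k, by omega⟩ +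
            ((m : ℤ) * ((m : ℤ) - 1) * k - 1) * (ρ ⟨0, by omega⟩ + ρ ⟨2 * k, by omega⟩) ∧
      setWeight ρ (Finset.univ.filter (memB2 k m)) =
          (((m : ℤ) - 1) * (2 * k) + (2 * m - 5)) * ρ ⟨k, by omega⟩ +
            (((m : ℤ) - 1) ^ 2 * (2 * k) - (2 * m - 3)) *
              (ρ ⟨0, by omega⟩ + ρ ⟨2 * k, by omega⟩) := by
  refine ⟨(isDegreeEnum_B1 hk hm).isMonomialBasis, (isDegreeEnum_B2 hk hm).isMonomialBasis,
    fun ρ hρ => ?_⟩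
  simp only [mk_eq_ribIdx]
  exact ⟨setWeight_B1 hk hm ρ hρ, setWeight_B2 hk hm ρ hρ⟩

end
end

section
/- For every m ≥ 2 and every integer weight vector ρ = (ρ_0,…,ρ_{2k}) with ρ_0+⋯+ρ_{2k} = 0, there exists a monomial basis of V_m of nonpositive ρ-weight. (By the Kempf–Morrison criterion, this is the combinatorial content of Theorem 4.1: all Hilbert points [C]_m, m ≥ 2, of the canonically embedded balanced ribbon of genus g are semistable.) -/
/-!
The combinatorial content of Theorem 4.1 (semistability of all Hilbert points of the
canonically embedded balanced ribbon of genus `g = 2k+1`): for every `m ≥ 2` and every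
integer weight vector `ρ = (ρ₀,…,ρ_{2k})` with `ρ₀ + ⋯ + ρ_{2k} = 0`, there exists a
monomial basis of `V_m` of nonpositive `ρ`-weight.
-/

noncomputable section

open scoped Classical

/-- The degree in `u` of a monomial. -/
def monIndex {k : ℕ} (σ : Multiset (Fin (2 * k + 1))) : ℕ :=
  (σ.map fun i : Fin (2 * k + 1) => (i : ℕ)).sum

/-- The coefficient of `ε` in a monomial, as a multiple of a power of `u`. -/
def monExcess {k : ℕ} (σ : Multiset (Fin (2 * k + 1))) : ℕ :=
  (σ.map fun i : Fin (2 * k + 1) => (i : ℕ) - k).sum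

/-- The excess is `0` unless some `y` occurs, and is the index minus `k` times the degree unless
some `x_i` with `i < k` occurs; in either exceptional case the index is bounded accordingly. -/
theorem monIndex_monExcess_bounds {k : ℕ} (σ : Multiset (Fin (2 * k + 1))) :
    monIndex σ ≤ 2 * k * σ.card ∧ monIndex σ ≤ monExcess σ + σ.card * k ∧
    (monExcess σ = 0 ∨ k + 1 ≤ monIndex σ) ∧
    (monExcess σ + σ.card * k = monIndex σ ∨ monIndex σ + k + 1 ≤ 2 * k * σ.card) := by
  induction σ using Multiset.induction with
  | empty => simp [monIndex, monExcess]
  | cons i σ ih =>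
    have hi := i.2
    simp only [monIndex, monExcess, Multiset.map_cons, Multiset.sum_cons, Multiset.card_cons,
      mul_add, add_mul, mul_one, one_mul] at ih ⊢
    omega

theorem monElem_eq {k : ℕ} (σ : Multiset (Fin (2 * k + 1))) :
    monElem k σ = TrivSqZeroExt.inl (Polynomial.X ^ monIndex σ) +
      TrivSqZeroExt.inr
        ((monExcess σ : Polynomial ℂ) * Polynomial.X ^ (monIndex σ - (k + 1))) := by
  induction σ using Multiset.induction with
  | empty => simp [monElem, monIndex, monExcess]
  | cons i σ ih =>
    have hA := (monIndex_monExcess_bounds σ).2.2.1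
    have h1 : monElem k (i ::ₘ σ) = ribVar k i * monElem k σ := by simp [monElem]
    have h2 : monIndex (i ::ₘ σ) = (i : ℕ) + monIndex σ := by simp [monIndex]
    have h3 : monExcess (i ::ₘ σ) = ((i : ℕ) - k) + monExcess σ := by simp [monExcess]
    rw [h1, h2, h3, ih]
    have e1 : (monExcess σ : Polynomial ℂ) * (Polynomial.X ^ (i : ℕ)
          * Polynomial.X ^ (monIndex σ - (k + 1)))
        = (monExcess σ : Polynomial ℂ) * Polynomial.X ^ ((i : ℕ) + monIndex σ - (k + 1)) := by
      rcases hA with h | h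
      · simp [h]
      · rw [← pow_add, Nat.add_sub_assoc h]
    unfold ribVar
    split_ifs with hik
    · ext1
      · simp [xvar, uPoly, pow_add]
      · simp only [xvar, uPoly, TrivSqZeroExt.snd_mul, TrivSqZeroExt.fst_inl,
          TrivSqZeroExt.snd_inl, TrivSqZeroExt.snd_add, TrivSqZeroExt.snd_inr,
          TrivSqZeroExt.fst_add, TrivSqZeroExt.fst_inr, smul_eq_mul, Nat.sub_eq_zero_of_le hik,
          smul_zero, zero_add, add_zero, ← e1]
        ring
    · have e2 : (Polynomial.X : Polynomial ℂ) ^ ((i : ℕ) + monIndex σ - (k + 1))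
          = Polynomial.X ^ ((i : ℕ) - k - 1) * Polynomial.X ^ monIndex σ := by
        rw [← pow_add]
        congr 1
        omega
      ext1
      · simp [yvar, uPoly, pow_add]
      · simp only [yvar, uPoly, TrivSqZeroExt.snd_mul, TrivSqZeroExt.fst_inl,
          TrivSqZeroExt.snd_inl, TrivSqZeroExt.snd_add, TrivSqZeroExt.snd_inr,
          TrivSqZeroExt.fst_add, TrivSqZeroExt.fst_inr, smul_eq_mul,
          zero_add, add_zero, MulOpposite.smul_eq_mul_unop, MulOpposite.unop_op, Nat.cast_add,
          add_mul, ← e1]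
        rw [e2]
        ring

theorem monElem_eq_of_eq_s5 {k : ℕ} {σ τ : Multiset (Fin (2 * k + 1))}
    (h1 : monIndex σ = monIndex τ) (h2 : monExcess σ = monExcess τ) :
    monElem k σ = monElem k τ := by
  rw [monElem_eq, monElem_eq, h1, h2]

theorem monElem_eq_combination {k : ℕ} {σ τ υ : Multiset (Fin (2 * k + 1))}
    (h1 : monIndex σ = monIndex τ) (h2 : monIndex υ = monIndex τ)
    (h : monExcess σ ≠ monExcess τ) :
    ∃ c : ℂ, monElem k υ = c • monElem k σ + (1 - c) • monElem k τ := by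
  have hne : (monExcess σ : ℂ) - monExcess τ ≠ 0 := by
    rw [sub_ne_zero]
    exact_mod_cast h
  refine ⟨((monExcess υ : ℂ) - monExcess τ) / (monExcess σ - monExcess τ), ?_⟩
  rw [monElem_eq, monElem_eq, monElem_eq, h1, h2]
  ext1
  · simp [← add_smul]
  · simp only [TrivSqZeroExt.snd_add, TrivSqZeroExt.snd_inl, TrivSqZeroExt.snd_inr,
      TrivSqZeroExt.snd_smul, zero_add, ← smul_mul_assoc, ← add_mul]
    congr 1
    simp only [← map_natCast Polynomial.C, Polynomial.smul_C, ← map_add]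
    congr 1
    simp only [smul_eq_mul]
    field_simp
    ring

theorem coeff_fst_monElem {k : ℕ} (σ : Multiset (Fin (2 * k + 1))) (D : ℕ) :
    (TrivSqZeroExt.fst (monElem k σ)).coeff D = if monIndex σ = D then 1 else 0 := by
  simp [monElem_eq, Polynomial.coeff_X_pow, eq_comm]

theorem coeff_snd_monElem {k : ℕ} (σ : Multiset (Fin (2 * k + 1))) {D : ℕ} (hD : k + 1 ≤ D) :
    (TrivSqZeroExt.snd (monElem k σ)).coeff (D - (k + 1))
      = if monIndex σ = D then (monExcess σ : ℂ) else 0 := by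
  rw [monElem_eq]
  simp only [TrivSqZeroExt.snd_add, TrivSqZeroExt.snd_inl, TrivSqZeroExt.snd_inr, zero_add,
    ← map_natCast Polynomial.C, Polynomial.coeff_C_mul, Polynomial.coeff_X_pow]
  rcases (monIndex_monExcess_bounds σ).2.2.1 with h | h
  · simp [h]
  · have : D - (k + 1) = monIndex σ - (k + 1) ↔ monIndex σ = D := by omega
    simp [this]

open Finset in
theorem exists_basis_of_pairs (k m : ℕ) (P Q : ℕ → DegMon k m)
    (hP : ∀ D ≤ 2 * k * m, monIndex (P D).1 = D)
    (hQ : ∀ D, k + 1 ≤ D → D + k + 1 ≤ 2 * k * m → monIndex (Q D).1 = D ∧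
      monExcess (P D).1 ≠ monExcess (Q D).1) (ρ : Fin (2 * k + 1) → ℤ) :
    ∃ S : Finset (DegMon k m), IsMonomialBasis k m S ∧
      setWeight ρ S = ∑ D ∈ range (2 * k * m + 1), monWeight ρ (P D)
        + ∑ D ∈ Ico (k + 1) (2 * k * m - k), monWeight ρ (Q D) := by
  set N := 2 * k * m with hN
  have hQ' : ∀ D ∈ Ico (k + 1) (N - k), monIndex (Q D).1 = D ∧
      monExcess (P D).1 ≠ monExcess (Q D).1 := by
    intro D hD
    rw [mem_Ico] at hD
    exact hQ D hD.1 (by omega)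
  have hP' : ∀ D ∈ range (N + 1), monIndex (P D).1 = D := by
    intro D hD
    exact hP D (Nat.lt_succ_iff.1 (mem_range.1 hD))
  set S := (range (N + 1)).image P ∪ (Ico (k + 1) (N - k)).image Q with hS
  have hdisj : Disjoint ((range (N + 1)).image P) ((Ico (k + 1) (N - k)).image Q) := by
    rw [disjoint_left]
    intro σ h1 h2
    obtain ⟨D, hD, rfl⟩ := mem_image.1 h1
    obtain ⟨D', hD', h⟩ := mem_image.1 h2
    have h3 := hQ' D' hD'
    have : D' = D := by rw [← h3.1, h, hP' D hD]
    subst this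
    exact h3.2 (by rw [h])
  have hsum : ∀ {M : Type} [AddCommMonoid M] (F : DegMon k m → M), ∑ σ ∈ S, F σ
      = ∑ D ∈ range (N + 1), F (P D) + ∑ D ∈ Ico (k + 1) (N - k), F (Q D) := by
    intro M _ F
    rw [hS, sum_union hdisj, sum_image, sum_image]
    · intro a ha b hb hab
      rw [← (hQ' a ha).1, hab, (hQ' b hb).1]
    · intro a ha b hb hab
      rw [← hP' a ha, hab, hP' b hb]
  refine ⟨S, ⟨?_, ?_⟩, hsum _⟩
  · change LinearIndepOn ℂ (fun σ : DegMon k m => monElem k σ.1) (S : Set (DegMon k m))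
    rw [linearIndepOn_finset_iff]
    intro f hf
    rw [hsum] at hf
    have hfst : ∀ D ∈ range (N + 1),
        f (P D) + (if D ∈ Ico (k + 1) (N - k) then f (Q D) else 0) = 0 := by
      intro D hD
      have h := congrArg (fun x : RibR => (TrivSqZeroExt.fst x).coeff D) hf
      simp only [TrivSqZeroExt.fst_add, TrivSqZeroExt.fst_sum, TrivSqZeroExt.fst_smul,
        Polynomial.coeff_add, Polynomial.finsetSum_coeff, Polynomial.coeff_smul,
        coeff_fst_monElem, TrivSqZeroExt.fst_zero, Polynomial.coeff_zero, smul_eq_mul] at h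
      rw [sum_congr rfl fun x hx => congrArg (f (P x) * if · = D then (1 : ℂ) else 0) (hP' x hx),
        sum_congr (s₁ := Ico _ _) rfl fun x hx =>
          congrArg (f (Q x) * if · = D then (1 : ℂ) else 0) (hQ' x hx).1] at h
      simpa only [mul_ite, mul_one, mul_zero, sum_ite_eq', hD, if_true] using h
    have hsnd : ∀ D ∈ Ico (k + 1) (N - k),
        f (P D) * monExcess (P D).1 + f (Q D) * monExcess (Q D).1 = 0 := by
      intro D hD
      have hD1 : k + 1 ≤ D := (mem_Ico.1 hD).1
      have hD2 : D ∈ range (N + 1) := by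
        rw [mem_Ico] at hD
        rw [mem_range]
        omega
      have h := congrArg (fun x : RibR => (TrivSqZeroExt.snd x).coeff (D - (k + 1))) hf
      simp only [TrivSqZeroExt.snd_add, TrivSqZeroExt.snd_sum, TrivSqZeroExt.snd_smul,
        Polynomial.coeff_add, Polynomial.finsetSum_coeff, Polynomial.coeff_smul,
        coeff_snd_monElem _ hD1, TrivSqZeroExt.snd_zero, Polynomial.coeff_zero,
        smul_eq_mul] at h
      rw [sum_congr rfl fun x hx =>
          congrArg (f (P x) * if · = D then (monExcess (P x).1 : ℂ) else 0) (hP' x hx),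
        sum_congr (s₁ := Ico _ _) rfl fun x hx =>
          congrArg (f (Q x) * if · = D then (monExcess (Q x).1 : ℂ) else 0) (hQ' x hx).1] at h
      simp only [mul_ite, mul_zero, sum_ite_eq', hD, hD2, if_true] at h
      exact h
    have hmid : ∀ D ∈ Ico (k + 1) (N - k), f (Q D) = 0 := by
      intro D hD
      have hD2 : D ∈ range (N + 1) := by
        rw [mem_Ico] at hD
        rw [mem_range]
        omega
      have h1 := hfst D hD2
      rw [if_pos hD] at h1
      have h2 := hsnd D hD
      have hne : (monExcess (Q D).1 : ℂ) - monExcess (P D).1 ≠ 0 := by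
        rw [sub_ne_zero]
        exact_mod_cast (hQ' D hD).2.symm
      have h3 : f (Q D) * ((monExcess (Q D).1 : ℂ) - monExcess (P D).1) = 0 := by
        linear_combination h2 - monExcess (P D).1 * h1
      exact (mul_eq_zero.1 h3).resolve_right hne
    intro σ hσ
    rcases mem_union.1 hσ with h | h
    · obtain ⟨D, hD, rfl⟩ := mem_image.1 h
      have h1 := hfst D hD
      split_ifs at h1 with h2
      · rwa [hmid D h2, add_zero] at h1
      · rwa [add_zero] at h1
    · obtain ⟨D, hD, rfl⟩ := mem_image.1 h
      exact hmid D hD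
  · apply le_antisymm
    · refine Submodule.span_mono ?_
      rintro _ ⟨σ, _, rfl⟩
      exact ⟨σ.1, σ.2, rfl⟩
    · refine Submodule.span_le.2 ?_
      rintro _ ⟨υ, hυ, rfl⟩
      have hb := monIndex_monExcess_bounds υ
      rw [hυ, ← hN] at hb
      set D := monIndex υ with hD
      have hDN : D ∈ range (N + 1) := mem_range.2 (by omega)
      have hPm : monElem k (P D).1 ∈ Submodule.span ℂ
          ((fun s : DegMon k m => monElem k s.1) '' (S : Set (DegMon k m))) :=
        Submodule.subset_span ⟨P D, mem_union_left _ (mem_image_of_mem _ hDN), rfl⟩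
      by_cases hmid : D ∈ Ico (k + 1) (N - k)
      · have hQm : monElem k (Q D).1 ∈ Submodule.span ℂ
            ((fun s : DegMon k m => monElem k s.1) '' (S : Set (DegMon k m))) :=
          Submodule.subset_span ⟨Q D, mem_union_right _ (mem_image_of_mem _ hmid), rfl⟩
        obtain ⟨c, hc⟩ := monElem_eq_combination (σ := (P D).1) (τ := (Q D).1) (υ := υ)
          (by rw [hP' D hDN, (hQ' D hmid).1]) (by rw [(hQ' D hmid).1]) (hQ' D hmid).2
        rw [hc]
        exact add_mem (Submodule.smul_mem _ _ hPm) (Submodule.smul_mem _ _ hQm)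
      · have hb' := monIndex_monExcess_bounds (P D).1
        rw [show (P D).1.card = m from (P D).2, ← hN, hP' D hDN] at hb'
        rw [mem_Ico] at hmid
        rw [monElem_eq_of_eq_s5 (σ := υ) (τ := (P D).1) (by rw [hP' D hDN]) (by omega)]
        exact hPm

open Finset in
theorem sum_antidiagonal_choose_mul_choose (d e n : ℕ) :
    ∑ p ∈ antidiagonal n, (d + p.1).choose d * (e + p.2).choose e
      = (d + e + 1 + n).choose (d + e + 1) := by
  have h := congrArg (PowerSeries.coeff n)
    (pow_add (PowerSeries.mk (1 : ℕ → ℤ)) (d + 1) (e + 1))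
  rw [show d + 1 + (e + 1) = (d + e + 1) + 1 by ring] at h
  simp only [PowerSeries.mk_one_pow_eq_mk_choose_add, PowerSeries.coeff_mul,
    PowerSeries.coeff_mk] at h
  exact_mod_cast h.symm

open Finset in
/-- If `h (d + i) ≤ f d + g i` for all `d ≤ a`, `i ≤ b`, then the mean of `h` over `[0, a + b]`
is at most the sum of the means of `f` over `[0, a]` and `g` over `[0, b]`. -/
theorem mean_le_mean_add_mean (a b : ℕ) (f g h : ℕ → ℤ)
    (H : ∀ d ≤ a, ∀ i ≤ b, h (d + i) ≤ f d + g i) :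
    ((a : ℤ) + 1) * (b + 1) * ∑ D ∈ range (a + b + 1), h D ≤
      (a + b + 1) * ((b + 1) * ∑ d ∈ range (a + 1), f d + (a + 1) * ∑ i ∈ range (b + 1), g i) := by
  set w : ℕ × ℕ → ℕ × ℕ → ℤ := fun p q => (p.1 + q.1).choose p.1 * (p.2 + q.2).choose p.2 with hw
  have hf : ∑ p ∈ antidiagonal a, ∑ q ∈ antidiagonal b, w p q * f p.1
      = (a + b + 1).choose (a + 1) * ∑ d ∈ range (a + 1), f d := by
    rw [← Nat.sum_antidiagonal_eq_sum_range_succ_mk (fun p => f p.1), mul_sum]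
    refine sum_congr rfl fun p hp => ?_
    rw [← sum_mul, ← mem_antidiagonal.1 hp, show p.1 + p.2 + b + 1 = p.1 + p.2 + 1 + b by ring,
      ← sum_antidiagonal_choose_mul_choose]
    push_cast
    rfl
  have hg : ∑ p ∈ antidiagonal a, ∑ q ∈ antidiagonal b, w p q * g q.1
      = (a + b + 1).choose (b + 1) * ∑ i ∈ range (b + 1), g i := by
    rw [← Nat.sum_antidiagonal_eq_sum_range_succ_mk (fun p => g p.1), mul_sum, sum_comm]
    refine sum_congr rfl fun q hq => ?_
    rw [← sum_mul, ← mem_antidiagonal.1 hq,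
      show a + (q.1 + q.2) + 1 = q.1 + q.2 + 1 + a by ring,
      ← sum_antidiagonal_choose_mul_choose]
    push_cast
    congr 1
    refine sum_congr rfl fun p _ => ?_
    simp only [hw]
    rw [Nat.choose_symm_add, Nat.choose_symm_add, add_comm p.1, add_comm p.2]
  have hh : ∑ p ∈ antidiagonal a, ∑ q ∈ antidiagonal b, w p q * h (p.1 + q.1)
      = (a + b).choose a * ∑ D ∈ range (a + b + 1), h D := by
    rw [← Nat.sum_antidiagonal_eq_sum_range_succ_mk (fun p => h p.1), mul_sum]
    have key : ∀ p ∈ antidiagonal a, ∑ q ∈ antidiagonal b, w p q * h (p.1 + q.1)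
        = ∑ P ∈ antidiagonal (a + b), (P.1.choose p.1 * P.2.choose p.2 : ℤ) * h P.1 := by
      intro p hp
      rw [HasAntidiagonal.mem_antidiagonal] at hp
      refine sum_of_injOn (fun q => (p.1 + q.1, p.2 + q.2)) ?_ ?_ ?_ ?_
      · rintro ⟨x, y⟩ _ ⟨x', y'⟩ _ hxy
        simpa using hxy
      · rintro ⟨x, y⟩ hq
        simp only [mem_coe, HasAntidiagonal.mem_antidiagonal] at hq ⊢
        omega
      · rintro ⟨x, y⟩ hP hn
        rw [HasAntidiagonal.mem_antidiagonal] at hP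
        simp only [Set.mem_image, mem_coe, HasAntidiagonal.mem_antidiagonal, Prod.mk.injEq,
          Prod.exists, not_exists, not_and] at hn hP
        have : x < p.1 ∨ y < p.2 := by
          by_contra hc
          exact hn (x - p.1) (y - p.2) (by omega) (by omega) (by omega)
        rcases this with h1 | h1 <;> simp [Nat.choose_eq_zero_of_lt h1]
      · intro q _
        rfl
    rw [sum_congr rfl key, sum_comm]
    refine sum_congr rfl fun P hP => ?_
    rw [← sum_mul, ← mem_antidiagonal.1 hP, Nat.add_choose_eq]
    push_cast
    rfl
  have hle : ((a + b).choose a : ℤ) * ∑ D ∈ range (a + b + 1), h D ≤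
      (a + b + 1).choose (a + 1) * ∑ d ∈ range (a + 1), f d
        + (a + b + 1).choose (b + 1) * ∑ i ∈ range (b + 1), g i := by
    rw [← hf, ← hg, ← hh, ← sum_add_distrib]
    refine sum_le_sum fun p hp => ?_
    rw [← sum_add_distrib]
    refine sum_le_sum fun q hq => ?_
    rw [← mul_add]
    rw [HasAntidiagonal.mem_antidiagonal] at hp hq
    exact mul_le_mul_of_nonneg_left (H _ (by omega) _ (by omega)) (by positivity)
  have h1 : ((a + b + 1).choose (a + 1) * (a + 1) : ℤ) = (a + b + 1) * (a + b).choose a := by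
    exact_mod_cast (Nat.add_one_mul_choose_eq (a + b) a).symm
  have h2 : ((a + b + 1).choose (b + 1) * (b + 1) : ℤ) = (a + b + 1) * (a + b).choose a := by
    rw [Nat.choose_symm_add]
    exact_mod_cast (Nat.add_one_mul_choose_eq (a + b) b).symm
  have hpos : (0 : ℤ) < (a + b).choose a := by
    exact_mod_cast Nat.choose_pos (Nat.le_add_right a b)
  refine le_of_mul_le_mul_left ?_ hpos
  have h3 := mul_le_mul_of_nonneg_left hle (show (0 : ℤ) ≤ (a + 1) * (b + 1) by positivity)
  set F := ∑ d ∈ range (a + 1), f d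
  set G := ∑ i ∈ range (b + 1), g i
  linear_combination h3 + (b + 1) * F * h1 + (a + 1) * G * h2

theorem sum_range_mul (f : ℕ → ℤ) (n k : ℕ) :
    ∑ D ∈ Finset.range (k * n), f D
      = ∑ q ∈ Finset.range n, ∑ r ∈ Finset.range k, f (k * q + r) := by
  induction n with
  | zero => simp
  | succ n ih => rw [mul_add, mul_one, Finset.sum_range_add, ih, Finset.sum_range_succ]

theorem sum_range_succ_cast (n : ℕ) : 2 * ∑ i ∈ Finset.range n, (i : ℤ) = n * (n - 1) := by
  induction n with
  | zero => simp
  | succ n ih => rw [Finset.sum_range_succ, mul_add, ih]; push_cast; ring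

/-- Total weight of the balanced monomials of degree `m` in variables of index `0, …, n`. -/
theorem two_mul_sum_balanced (r : ℕ → ℤ) (n m : ℕ) :
    2 * ∑ D ∈ Finset.range (m * n + 1),
        (((m : ℤ) - (D % m : ℕ)) * r (D / m) + (D % m : ℕ) * r (D / m + 1))
      = 2 * m ^ 2 * ∑ i ∈ Finset.range (n + 1), r i - m * (m - 1) * (r 0 + r n) := by
  rcases Nat.eq_zero_or_pos m with rfl | hm
  · simp
  rw [Finset.sum_range_succ, sum_range_mul, mul_add]
  have hblock : ∀ q, 2 * ∑ t ∈ Finset.range m,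
      (((m : ℤ) - ((m * q + t) % m : ℕ)) * r ((m * q + t) / m)
        + ((m * q + t) % m : ℕ) * r ((m * q + t) / m + 1))
      = m * (m + 1) * r q + m * (m - 1) * r (q + 1) := by
    intro q
    have : ∀ t ∈ Finset.range m, (((m : ℤ) - ((m * q + t) % m : ℕ)) * r ((m * q + t) / m)
        + ((m * q + t) % m : ℕ) * r ((m * q + t) / m + 1))
        = m * r q + (t : ℤ) * (r (q + 1) - r q) := by
      intro t ht
      have ht := Finset.mem_range.1 ht
      rw [Nat.mul_add_mod, Nat.mod_eq_of_lt ht, Nat.mul_add_div hm, Nat.div_eq_of_lt ht, add_zero]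
      ring
    rw [Finset.sum_congr rfl this, Finset.sum_add_distrib, Finset.sum_const, Finset.card_range,
      nsmul_eq_mul, ← Finset.sum_mul]
    linear_combination (r (q + 1) - r q) * sum_range_succ_cast m
  rw [Finset.mul_sum, Finset.sum_congr rfl fun q _ => hblock q, Finset.sum_add_distrib,
    ← Finset.mul_sum, ← Finset.mul_sum]
  have h1 := Finset.sum_range_succ r n
  have h2 := Finset.sum_range_succ' r n
  simp only [Nat.mul_mod_right, Nat.mul_div_cancel_left n hm]
  push_cast
  linear_combination (-m * (m + 1) : ℤ) * h1 - (m * (m - 1) : ℤ) * h2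

/-- Total weight of the monomials of degree `j` in three variables of index `0, 1, 2` with
weights `x, y, z` whose exponents are as extreme as possible. -/
theorem sum_extreme (x y z : ℤ) (j : ℕ) :
    ∑ q ∈ Finset.range (2 * j + 1),
        ((q / 2 : ℕ) * z + (q % 2 : ℕ) * y + ((j : ℤ) - (q / 2 : ℕ) - (q % 2 : ℕ)) * x)
      = j ^ 2 * (x + z) + j * y := by
  have hblock : ∀ c, ∑ t ∈ Finset.range 2, (((2 * c + t) / 2 : ℕ) * z + ((2 * c + t) % 2 : ℕ) * y
      + ((j : ℤ) - ((2 * c + t) / 2 : ℕ) - ((2 * c + t) % 2 : ℕ)) * x)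
      = y + (2 * j - 1) * x + (c : ℤ) * (2 * (z - x)) := by
    intro c
    rw [Finset.sum_range_succ, Finset.sum_range_one, show (2 * c + 0) / 2 = c by omega,
      show (2 * c + 1) / 2 = c by omega, show (2 * c + 0) % 2 = 0 by omega,
      show (2 * c + 1) % 2 = 1 by omega]
    push_cast
    ring
  rw [Finset.sum_range_succ, sum_range_mul, Finset.sum_congr rfl fun c _ => hblock c,
    Finset.sum_add_distrib, ← Finset.sum_mul]
  simp only [Finset.sum_const, Finset.card_range, nsmul_eq_mul]
  rw [show 2 * j / 2 = j by omega, show 2 * j % 2 = 0 by omega]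
  push_cast
  linear_combination (z - x) * sum_range_succ_cast j

/-- Total weight of the chain of pairs `(0, k+1), (1, k+1), (1, k+2), …, (k-1, 2k)`. -/
theorem sum_chain (r : ℕ → ℤ) (n : ℕ) :
    ∑ e ∈ Finset.range (2 * n + 1), (r ((e + 1) / 2) + r (n + 2 + e / 2))
      = 2 * ∑ i ∈ Finset.range (2 * n + 3), r i - (r 0 + r (2 * n + 2)) - 2 * r (n + 1) := by
  have hchain : ∀ f g : ℕ → ℤ, ∀ t, ∑ e ∈ Finset.range (2 * t + 1), (f ((e + 1) / 2) + g (e / 2))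
      = 2 * ∑ i ∈ Finset.range (t + 1), f i - f 0
        + (2 * ∑ i ∈ Finset.range (t + 1), g i - g t) := by
    intro f g t
    induction t with
    | zero => simp; ring
    | succ t ih =>
      rw [show 2 * (t + 1) + 1 = (2 * t + 1) + 1 + 1 by ring, Finset.sum_range_succ,
        Finset.sum_range_succ, ih, Finset.sum_range_succ f (t + 1),
        Finset.sum_range_succ g (t + 1), show (2 * t + 1 + 1) / 2 = t + 1 by omega,
        show (2 * t + 1) / 2 = t by omega, show (2 * t + 1 + 1 + 1) / 2 = t + 1 by omega]
      ring
  rw [hchain r (fun i => r (n + 2 + i)), show 2 * n + 3 = (n + 1) + 1 + (n + 1) by ring,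
    Finset.sum_range_add r (n + 1 + 1), Finset.sum_range_succ r (n + 1),
    show n + 2 + n = 2 * n + 2 by ring]
  simp only [show n + 1 + 1 = n + 2 by ring]
  ring

theorem mul_sub_one_nonneg {p : ℤ} (hp : 0 ≤ p) : 0 ≤ p * (p - 1) := by
  rcases hp.eq_or_lt with rfl | h
  · simp
  · exact mul_nonneg hp (by omega)

/-- Here `k = n + 1` and `m = p + 2`; compare `exists_basis_extreme`. -/
theorem slope_extreme_le {n p : ℤ} (hn : 0 ≤ n) (hp : 0 ≤ p) :
    (2 * (n + 1) * (p + 1) + 2 * (p + 2) - 5)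
        * ((2 * n + 1) * ((p + 2) * (p + 1)) + 4 * (2 * (n + 1) * (p + 1) - 1))
      ≤ 2 * (2 * p + 3) * (2 * (n + 1) * (p + 1) - 1) ^ 2 := by
  have hp' := mul_sub_one_nonneg hp
  nlinarith [mul_nonneg hn hp, mul_nonneg hp' hp, mul_nonneg hp' hn,
    mul_nonneg (mul_nonneg hp' hp) hn, mul_nonneg (mul_nonneg hp hn) hn,
    mul_nonneg (mul_nonneg (mul_nonneg hp' hp) hn) hn, mul_nonneg (mul_nonneg hp' hn) hn]

/-- Here `k = n + 1` and `m = p + 2`; compare `exists_basis_of_balanced_step`. -/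
theorem le_slope_balanced {n p : ℤ} (hn : 0 ≤ n) (hp : 0 ≤ p) :
    2 * (2 * p + 3) * (2 * (n + 1) * (p + 1) - 1) ^ 2
      ≤ (2 * (n + 1) * (p + 1) ^ 2 - 2 * (p + 2) + 3)
        * ((2 * n + 1) * ((p + 2) * (p + 1)) + 4 * (2 * (n + 1) * (p + 1) - 1)) := by
  have hp' := mul_sub_one_nonneg hp
  nlinarith [mul_nonneg hn hp, mul_nonneg hp' hp, mul_nonneg hp' hn,
    mul_nonneg (mul_nonneg hp' hp) hn, mul_nonneg (mul_nonneg hp hn) hn,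
    mul_nonneg (mul_nonneg (mul_nonneg hp' hp) hn) hn, mul_nonneg (mul_nonneg hp' hn) hn,
    mul_nonneg (mul_nonneg hp' hp) hp, mul_nonneg (mul_nonneg (mul_nonneg hp' hp) hp) hn,
    mul_nonneg (mul_nonneg (mul_nonneg (mul_nonneg hp' hp) hp) hn) hn]
/-- There is a monomial of degree `m` with index `D`, excess `s` and weight `w`. -/
def Realizes (k : ℕ) (r : ℕ → ℤ) (m D s : ℕ) (w : ℤ) : Prop :=
  ∃ σ : Multiset (Fin (2 * k + 1)), σ.card = m ∧ monIndex σ = D ∧ monExcess σ = s ∧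
    (σ.map fun i : Fin (2 * k + 1) => r i).sum = w

namespace Realizes

variable {k : ℕ} {r : ℕ → ℤ}

theorem congr {m m' D D' s s' : ℕ} {w w' : ℤ} (h : Realizes k r m D s w) (hm : m = m')
    (hD : D = D') (hs : s = s') (hw : w = w') : Realizes k r m' D' s' w' := by
  subst hm hD hs hw
  exact h

theorem replicate {n i : ℕ} (h : n = 0 ∨ i ≤ 2 * k) :
    Realizes k r n (n * i) (n * (i - k)) (n * r i) := by
  rcases Nat.eq_zero_or_pos n with rfl | hn
  · exact ⟨0, by simp [monIndex, monExcess]⟩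
  · refine ⟨Multiset.replicate n ⟨i, by omega⟩, ?_⟩
    simp [monIndex, monExcess]

theorem single {i : ℕ} (h : i ≤ 2 * k) : Realizes k r 1 i (i - k) (r i) :=
  (replicate (n := 1) (Or.inr h)).congr rfl (one_mul _) (one_mul _) (by simp)

theorem add {m m' D D' s s' : ℕ} {w w' : ℤ} (h : Realizes k r m D s w)
    (h' : Realizes k r m' D' s' w') : Realizes k r (m + m') (D + D') (s + s') (w + w') := by
  obtain ⟨σ, rfl, rfl, rfl, rfl⟩ := h
  obtain ⟨τ, rfl, rfl, rfl, rfl⟩ := h'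
  exact ⟨σ + τ, by simp [monIndex, monExcess]⟩

theorem le_add {m D s : ℕ} {w : ℤ} (h : Realizes k r m D s w) : D ≤ s + m * k := by
  obtain ⟨σ, rfl, rfl, rfl, rfl⟩ := h
  exact (monIndex_monExcess_bounds σ).2.1

/-- The balanced monomial of degree `j` in the variables of index `0, c, …, n * c`. -/
theorem balanced {c n j D : ℕ} (hc : c * n ≤ 2 * k) (hD : D ≤ j * n) :
    Realizes k r j (c * D) ((j - D % j) * (c * (D / j) - k) + D % j * (c * (D / j + 1) - k))
      (((j : ℤ) - (D % j : ℕ)) * r (c * (D / j)) + (D % j : ℕ) * r (c * (D / j + 1))) := by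
  rcases Nat.eq_zero_or_pos j with rfl | hj
  · obtain rfl : D = 0 := by omega
    exact (replicate (n := 0) (i := 0) (Or.inl rfl)).congr rfl (by simp) (by simp) (by simp)
  have hmod := Nat.mod_lt D hj
  have hdm := Nat.div_add_mod D j
  have h1 : c * (D / j) ≤ 2 * k :=
    (Nat.mul_le_mul_left c (Nat.div_le_of_le_mul hD)).trans hc
  have h2 : D % j = 0 ∨ c * (D / j + 1) ≤ 2 * k := by
    rcases Nat.eq_zero_or_pos (D % j) with h | h
    · exact Or.inl h
    · have : D / j < n := by
        by_contra! hn
        have := Nat.mul_le_mul_left j hn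
        omega
      exact Or.inr ((Nat.mul_le_mul_left c this).trans hc)
  refine ((replicate (n := j - D % j) (Or.inr h1)).add (replicate h2)).congr
    (by omega) ?_ rfl ?_
  · conv_rhs => rw [← hdm]
    obtain ⟨t, ht⟩ := Nat.exists_eq_add_of_lt hmod
    rw [show j - D % j = t + 1 by omega]
    generalize D % j = x at *
    generalize D / j = y at *
    subst ht
    ring
  · rw [Nat.cast_sub hmod.le]

end Realizes

open Finset in
theorem exists_basis_of_realizes {k m : ℕ} {r p q : ℕ → ℤ} {sp sq : ℕ → ℕ}
    (hp : ∀ D ≤ 2 * k * m, Realizes k r m D (sp D) (p D))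
    (hq : ∀ D, k + 1 ≤ D → D + k + 1 ≤ 2 * k * m → Realizes k r m D (sq D) (q D) ∧
      sp D ≠ sq D) :
    ∃ S : Finset (DegMon k m), IsMonomialBasis k m S ∧
      setWeight (fun i => r i) S = ∑ D ∈ range (2 * k * m + 1), p D
        + ∑ D ∈ Ico (k + 1) (2 * k * m - k), q D := by
  have hp' : ∀ D, ∃ σ : DegMon k m, D ≤ 2 * k * m →
      monIndex σ.1 = D ∧ monExcess σ.1 = sp D ∧
        (σ.1.map fun i : Fin (2 * k + 1) => r i).sum = p D := by
    intro D
    by_cases h : D ≤ 2 * k * m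
    · obtain ⟨σ, h1, h2⟩ := hp D h
      exact ⟨⟨σ, h1⟩, fun _ => h2⟩
    · exact ⟨Sym.replicate m 0, fun h' => absurd h' h⟩
  have hq' : ∀ D, ∃ σ : DegMon k m, k + 1 ≤ D → D + k + 1 ≤ 2 * k * m →
      monIndex σ.1 = D ∧ monExcess σ.1 = sq D ∧
        (σ.1.map fun i : Fin (2 * k + 1) => r i).sum = q D := by
    intro D
    by_cases h : k + 1 ≤ D ∧ D + k + 1 ≤ 2 * k * m
    · obtain ⟨σ, h1, h2⟩ := (hq D h.1 h.2).1
      exact ⟨⟨σ, h1⟩, fun _ _ => h2⟩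
    · exact ⟨Sym.replicate m 0, fun h1 h2 => absurd ⟨h1, h2⟩ h⟩
  choose P hP using hp'
  choose Q hQ using hq'
  obtain ⟨S, hS, hw⟩ := exists_basis_of_pairs k m P Q (fun D hD => (hP D hD).1)
    (fun D h1 h2 => ⟨(hQ D h1 h2).1, by
      rw [(hP D (by omega)).2.1, (hQ D h1 h2).2.1]
      exact (hq D h1 h2).2⟩) fun i => r i
  refine ⟨S, hS, hw.trans ?_⟩
  congr 1
  · exact sum_congr rfl fun D hD => (hP D (Nat.lt_succ_iff.1 (mem_range.1 hD))).2.2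
  · refine sum_congr rfl fun D hD => ?_
    rw [mem_Ico] at hD
    exact (hQ D hD.1 (by omega)).2.2

open Finset in
theorem exists_convolution_sum_le (a b : ℕ) (f g : ℕ → ℤ) : ∃ h : ℕ → ℤ,
    (∀ D ≤ a + b, ∃ d ≤ a, ∃ i ≤ b, d + i = D ∧ h D = f d + g i) ∧
    ((a : ℤ) + 1) * (b + 1) * ∑ D ∈ range (a + b + 1), h D ≤
      (a + b + 1) * ((b + 1) * ∑ d ∈ range (a + 1), f d + (a + 1) * ∑ i ∈ range (b + 1), g i) := by
  have hmin : ∀ D, ∃ v : ℤ, D ≤ a + b → (∃ d ≤ a, ∃ i ≤ b, d + i = D ∧ v = f d + g i) ∧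
      ∀ d ≤ a, ∀ i ≤ b, d + i = D → v ≤ f d + g i := by
    intro D
    by_cases hD : D ≤ a + b
    · obtain ⟨x, hx, hx'⟩ := exists_min_image
        ((antidiagonal D).filter fun x => x.1 ≤ a ∧ x.2 ≤ b) (fun x => f x.1 + g x.2)
        ⟨(min a D, D - min a D), by
          rw [mem_filter, HasAntidiagonal.mem_antidiagonal]
          dsimp only
          omega⟩
      simp only [mem_filter, HasAntidiagonal.mem_antidiagonal] at hx hx'
      exact ⟨f x.1 + g x.2, fun _ => ⟨⟨x.1, hx.2.1, x.2, hx.2.2, hx.1, rfl⟩,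
        fun d hd i hi h => hx' (d, i) ⟨h, hd, hi⟩⟩⟩
    · exact ⟨0, fun h => absurd h hD⟩
  choose h hh using hmin
  exact ⟨h, fun D hD => (hh D hD).1, mean_le_mean_add_mean a b f g h
    fun d hd i hi => (hh (d + i) (by omega)).2 d hd i hi rfl⟩

open Finset in
/-- The Hilbert points of the rational normal curve are semistable. -/
theorem exists_realizes_sum_nonpos {k : ℕ} {r : ℕ → ℤ} (hr : ∑ i ∈ range (2 * k + 1), r i = 0)
    (j : ℕ) : ∃ (w : ℕ → ℤ) (s : ℕ → ℕ), (∀ D ≤ 2 * k * j, Realizes k r j D (s D) (w D)) ∧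
      ∑ D ∈ range (2 * k * j + 1), w D ≤ 0 := by
  induction j with
  | zero =>
    refine ⟨0, 0, fun D hD => ?_, by simp⟩
    exact (Realizes.replicate (n := 0) (i := 0) (Or.inl rfl)).congr rfl (by omega) (by simp)
      (by simp)
  | succ j ih =>
    obtain ⟨w, s, hw, hsum⟩ := ih
    obtain ⟨h, hh, hle⟩ := exists_convolution_sum_le (2 * k * j) (2 * k) w r
    have hs : ∀ D, ∃ t, D ≤ 2 * k * (j + 1) → Realizes k r (j + 1) D t (h D) := by
      intro D
      by_cases hD : D ≤ 2 * k * (j + 1)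
      · obtain ⟨d, hd, i, hi, rfl, h1⟩ := hh D hD
        exact ⟨_, fun _ => ((hw d hd).add (Realizes.single hi)).congr rfl rfl rfl h1.symm⟩
      · exact ⟨0, fun h => absurd h hD⟩
    choose t ht using hs
    refine ⟨h, t, ht, ?_⟩
    rw [hr, mul_zero, add_zero] at hle
    refine le_of_mul_le_mul_left (a := ((2 * k * j : ℕ) + 1) * ((2 * k : ℕ) + 1 : ℤ)) ?_
      (by positivity)
    rw [mul_zero]
    refine hle.trans (mul_nonpos_of_nonneg_of_nonpos (by positivity)
      (mul_nonpos_of_nonneg_of_nonpos (by positivity) hsum))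

open Finset in
/-- A basis made of balanced monomials and of multiples of the quadrics
`x_0 y_{k+1}, x_1 y_{k+1}, x_1 y_{k+2}, …, x_{k-1} y_{2k}`, where `k = n + 1`, `m = p + 2`. -/
theorem exists_basis_balanced (n p : ℕ) {r : ℕ → ℤ}
    (hr : ∑ i ∈ range (2 * (n + 1) + 1), r i = 0) :
    ∃ S : Finset (DegMon (n + 1) (p + 2)), IsMonomialBasis (n + 1) (p + 2) S ∧
      2 * (2 * (n : ℤ) + 1) * setWeight (fun i => r i) S ≤
        -((2 * n + 1) * ((p + 2) * (p + 1)) + 2 * (2 * (n + 1) * (p + 1) - 1))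
            * (r 0 + r (2 * (n + 1)))
          - 4 * (2 * (n + 1) * (p + 1) - 1) * r (n + 1) := by
  obtain ⟨w, s, hw, hwsum⟩ := exists_realizes_sum_nonpos hr p
  set f : ℕ → ℤ := fun e => r ((e + 1) / 2) + r (n + 2 + e / 2) with hf
  have hfr : ∀ d ≤ 2 * n, Realizes (n + 1) r 2 (d + (n + 1 + 1)) (1 + d / 2) (f d) := by
    intro d hd
    exact ((Realizes.single (i := (d + 1) / 2) (by omega)).add
      (Realizes.single (i := n + 2 + d / 2) (by omega))).congr rfl (by omega) (by omega) rfl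
  obtain ⟨h, hh, hle⟩ := exists_convolution_sum_le (2 * n) (2 * (n + 1) * p) f w
  have hN : 2 * (n + 1) * (p + 2) = 2 * n + 2 * (n + 1) * p + 2 * (n + 1 + 1) := by ring
  have hq : ∀ D, ∃ t, n + 1 + 1 ≤ D → D + (n + 1) + 1 ≤ 2 * (n + 1) * (p + 2) →
      Realizes (n + 1) r (p + 2) D t (h (D - (n + 1 + 1))) ∧
        0 < t ∧ D < t + (p + 2) * (n + 1) := by
    intro D
    by_cases hD : n + 1 + 1 ≤ D ∧ D + (n + 1) + 1 ≤ 2 * (n + 1) * (p + 2)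
    · obtain ⟨d, hd, i, hi, hdi, h1⟩ := hh (D - (n + 1 + 1)) (by omega)
      refine ⟨1 + d / 2 + s i, fun _ _ => ⟨((hfr d hd).add (hw i hi)).congr (by ring) (by omega)
        rfl h1.symm, by omega, ?_⟩⟩
      have h2 := (hw i hi).le_add
      rw [add_mul]
      omega
    · exact ⟨0, fun h1 h2 => absurd ⟨h1, h2⟩ hD⟩
  choose t ht using hq
  have hp : ∀ D ≤ 2 * (n + 1) * (p + 2), Realizes (n + 1) r (p + 2) D _ _ := fun D hD =>
    (Realizes.balanced (c := 1) (n := 2 * (n + 1)) (j := p + 2) (D := D) (by omega)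
      (by rwa [mul_comm])).congr rfl (one_mul D) rfl rfl
  obtain ⟨S, hS, hS'⟩ := exists_basis_of_realizes hp (sq := t)
    (q := fun D => h (D - (n + 1 + 1))) (by
      intro D h1 h2
      refine ⟨(ht D h1 h2).1, ?_⟩
      obtain ⟨-, h3, h4⟩ := ht D h1 h2
      have hmod := Nat.mod_lt D (show 0 < p + 2 by omega)
      have hdm := Nat.div_add_mod D (p + 2)
      intro h5
      rw [one_mul, one_mul] at h5
      rcases Nat.lt_or_ge (D / (p + 2)) (n + 1) with h6 | h6
      · rw [Nat.sub_eq_zero_of_le h6, Nat.sub_eq_zero_of_le h6.le] at h5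
        simp only [mul_zero, add_zero] at h5
        omega
      · obtain ⟨y, hy⟩ := Nat.exists_eq_add_of_le h6
        obtain ⟨x, hx⟩ := Nat.exists_eq_add_of_lt hmod
        rw [hy, show n + 1 + y - (n + 1) = y by omega,
          show n + 1 + y + 1 - (n + 1) = y + 1 by omega,
          show p + 2 - D % (p + 2) = x + 1 by omega] at h5
        rw [hy] at hdm
        generalize D % (p + 2) = z at *
        rw [← h5, ← hdm, hx] at h4
        apply h4.ne
        ring)
  refine ⟨S, hS, ?_⟩
  have hbal := two_mul_sum_balanced r (2 * (n + 1)) (p + 2)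
  rw [hr] at hbal
  have hchain := sum_chain r n
  rw [show 2 * n + 3 = 2 * (n + 1) + 1 by ring, hr, show 2 * n + 2 = 2 * (n + 1) by ring]
    at hchain
  rw [sum_Ico_eq_sum_range, show 2 * (n + 1) * (p + 2) - (n + 1) - (n + 1 + 1)
    = 2 * n + 2 * (n + 1) * p + 1 by omega] at hS'
  simp only [one_mul, Nat.add_sub_cancel_left] at hS'
  rw [mul_comm (p + 2)] at hbal
  rw [hchain] at hle
  set W := ∑ D ∈ range (2 * n + 2 * (n + 1) * p + 1), h D
  have hle' : (2 * (n : ℤ) + 1) * W ≤ (2 * n + 2 * (n + 1) * p + 1)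
      * (-(r 0 + r (2 * (n + 1))) - 2 * r (n + 1)) := by
    refine le_of_mul_le_mul_left (a := ((2 * (n + 1) * p : ℕ) + 1 : ℤ)) ?_ (by positivity)
    have h7 : ((2 * n : ℕ) + (2 * (n + 1) * p : ℕ) + 1) * (((2 * n : ℕ) + 1)
        * ∑ i ∈ range (2 * (n + 1) * p + 1), w i) ≤ 0 :=
      mul_nonpos_of_nonneg_of_nonpos (by positivity)
        (mul_nonpos_of_nonneg_of_nonpos (by positivity) hwsum)
    push_cast at hle h7 ⊢
    linear_combination hle + h7
  rw [hS']
  push_cast at hbal ⊢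
  linear_combination (2 * (n : ℤ) + 1) * hbal + 2 * hle'

open Finset in
/-- A basis made of products of a single variable with monomials in `x_0`, `x_k`, `y_{2k}`, where
`k = n + 1` and `m = p + 2`. -/
theorem exists_basis_of_step (n p : ℕ) {r : ℕ → ℤ}
    (hr : ∑ i ∈ range (2 * (n + 1) + 1), r i = 0) {t₀ t₁ : ℕ → ℤ} {c₀ c₁ : ℕ → ℕ}
    (h₀ : ∀ q ≤ 2 * p, Realizes (n + 1) r p ((n + 1) * q) ((n + 1) * c₀ q) (t₀ q))
    (h₁ : ∀ q ≤ 2 * (p + 1), Realizes (n + 1) r (p + 1) ((n + 1) * q) ((n + 1) * c₁ q) (t₁ q)) :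
    ∃ S : Finset (DegMon (n + 1) (p + 2)), IsMonomialBasis (n + 1) (p + 2) S ∧
      setWeight (fun i => r i) S = 2 * n * ∑ q ∈ range (2 * (p + 1) + 1), t₁ q
        + 2 * ∑ q ∈ range (2 * p + 1), t₀ q
        + (2 * p + 1) * (r 0 + r (2 * (n + 1)) + r (n + 1)) := by
  set u : ℕ → ℕ → ℤ := fun q i =>
    if i = 0 then
      if q = 0 then (p + 2) * r 0
      else if q = 1 then (p + 1) * r 0 + r (n + 1)
      else if q ≤ 2 * p + 2 then t₀ (q - 2) + (r 0 + r (2 * (n + 1)))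
      else if q = 2 * p + 3 then r (n + 1) + (p + 1) * r (2 * (n + 1))
      else (p + 2) * r (2 * (n + 1))
    else if q ≤ 2 * p + 2 then t₁ q + r i
    else t₁ (2 * p + 2) + r (n + 1 + i) with hu
  set v : ℕ → ℕ → ℤ := fun q i =>
    if i = 0 then if q < 2 then 0 else t₀ (q - 2) + 2 * r (n + 1)
    else t₁ (q - 1) + r (n + 1 + i) with hv
  have hp : ∀ q, ∀ i < n + 1, ∃ s, (n + 1) * q + i ≤ (n + 1) * (2 * p + 4) →
      Realizes (n + 1) r (p + 2) ((n + 1) * q + i) s (u q i) ∧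
      (q ≤ 2 * p + 2 → (i = 0 → 2 ≤ q → s = (n + 1) * (c₀ (q - 2) + 1)) ∧
        (i ≠ 0 → (n + 1) ∣ s)) := by
    intro q i hi
    rcases Nat.eq_zero_or_pos i with rfl | hi0
    · by_cases hq0 : q = 0
      · subst hq0
        refine ⟨_, fun _ => ⟨(Realizes.replicate (n := p + 2) (i := 0) (Or.inr (by omega))).congr
          rfl (by simp) rfl (by simp [hu]), by omega⟩⟩
      by_cases hq1 : q = 1
      · subst hq1
        refine ⟨_, fun _ => ⟨((Realizes.replicate (n := p + 1) (i := 0) (Or.inr (by omega))).add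
          (Realizes.single (i := n + 1) (by omega))).congr
          rfl (by simp) rfl (by simp [hu]), by omega⟩⟩
      by_cases hq2 : q ≤ 2 * p + 2
      · obtain ⟨j, rfl⟩ := Nat.exists_eq_add_of_le' (show 2 ≤ q by omega)
        refine ⟨_, fun _ => ⟨((h₀ j (by omega)).add ((Realizes.single (i := 0) (by omega)).add
          (Realizes.single (i := 2 * (n + 1)) le_rfl))).congr
          rfl (by ring) rfl (by simp [hu, hq2]), fun _ => ⟨fun _ _ => ?_, by omega⟩⟩⟩
        rw [Nat.add_sub_cancel, mul_add_one (n + 1)]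
        omega
      by_cases hq3 : q = 2 * p + 3
      · subst hq3
        refine ⟨_, fun _ => ⟨((Realizes.single (i := n + 1) (by omega)).add
          (Realizes.replicate (n := p + 1) (i := 2 * (n + 1)) (Or.inr le_rfl))).congr
          (by omega) (by ring) rfl (by simp [hu]), by omega⟩⟩
      · refine ⟨(p + 2) * (2 * (n + 1) - (n + 1)), fun h => ?_⟩
        obtain rfl : q = 2 * p + 4 := by
          have := Nat.le_of_mul_le_mul_left h (by omega)
          omega
        exact ⟨(Realizes.replicate (n := p + 2) (i := 2 * (n + 1)) (Or.inr le_rfl)).congr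
          rfl (by ring) rfl (by simp [hu]), by omega⟩
    · by_cases hq2 : q ≤ 2 * p + 2
      · refine ⟨_, fun _ => ⟨((h₁ q (by omega)).add (Realizes.single (i := i) (by omega))).congr
          rfl rfl rfl (by simp [hu, hq2, hi0.ne']), fun _ => ⟨by omega, fun _ => ?_⟩⟩⟩
        rw [Nat.sub_eq_zero_of_le hi.le]
        exact Dvd.intro _ rfl
      · refine ⟨(n + 1) * c₁ (2 * p + 2) + (n + 1 + i - (n + 1)), fun h => ?_⟩
        obtain rfl : q = 2 * p + 3 := by
          have := Nat.lt_of_mul_lt_mul_left (a := n + 1) (b := q) (c := 2 * p + 4) (by omega)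
          omega
        exact ⟨((h₁ (2 * p + 2) (by omega)).add (Realizes.single (i := n + 1 + i)
          (by omega))).congr rfl (by ring) rfl (by simp [hu, hi0.ne']), by omega⟩
  have hq : ∀ q, ∀ i < n + 1, ∃ s, 1 ≤ q → (i = 0 → 2 ≤ q) → q ≤ 2 * p + 2 →
      Realizes (n + 1) r (p + 2) ((n + 1) * q + i) s (v q i) ∧
      (i = 0 → s = (n + 1) * c₀ (q - 2)) ∧ (i ≠ 0 → ¬ (n + 1) ∣ s) := by
    intro q i hi
    rcases Nat.eq_zero_or_pos i with rfl | hi0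
    · refine ⟨(n + 1) * c₀ (q - 2), fun _ h h' => ?_⟩
      obtain ⟨j, rfl⟩ := Nat.exists_eq_add_of_le' (h rfl)
      exact ⟨((h₀ j (by omega)).add (Realizes.replicate (n := 2) (i := n + 1)
          (Or.inr (by omega)))).congr
          rfl (by ring) (by simp) (by simp [hv]), by simp, by simp⟩
    · refine ⟨(n + 1) * c₁ (q - 1) + (n + 1 + i - (n + 1)), fun h _ h' => ?_⟩
      obtain ⟨j, rfl⟩ := Nat.exists_eq_add_of_le' h
      refine ⟨((h₁ j (by omega)).add (Realizes.single (i := n + 1 + i) (by omega))).congr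
          rfl (by ring) rfl (by simp [hv, hi0.ne']), by omega, fun _ => ?_⟩
      rw [Nat.add_sub_cancel_left, Nat.dvd_add_right (Dvd.intro _ rfl)]
      exact Nat.not_dvd_of_pos_of_lt hi0 hi
  choose sp hsp using hp
  choose sq hsq using hq
  have hN : 2 * (n + 1) * (p + 2) = (n + 1) * (2 * p + 4) := by ring
  have hlt : ∀ D, D % (n + 1) < n + 1 := fun D => Nat.mod_lt D n.succ_pos
  obtain ⟨S, hS, hS'⟩ := exists_basis_of_realizes (r := r) (k := n + 1) (m := p + 2)
    (p := fun D => u (D / (n + 1)) (D % (n + 1))) (q := fun D => v (D / (n + 1)) (D % (n + 1)))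
    (sp := fun D => sp (D / (n + 1)) (D % (n + 1)) (hlt D))
    (sq := fun D => sq (D / (n + 1)) (D % (n + 1)) (hlt D))
    (fun D hD => by
      have h := hsp (D / (n + 1)) (D % (n + 1)) (hlt D)
      rw [Nat.div_add_mod, ← hN] at h
      exact (h hD).1) (by
      intro D h1 h2
      have hD := Nat.div_add_mod D (n + 1)
      have hi := hlt D
      have hs := hsp (D / (n + 1)) (D % (n + 1)) hi
      have ht := hsq (D / (n + 1)) (D % (n + 1)) hi
      rw [hD, ← hN] at hs
      rw [hD] at ht
      generalize sp (D / (n + 1)) (D % (n + 1)) hi = a at *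
      generalize sq (D / (n + 1)) (D % (n + 1)) hi = b at *
      have h3 : 1 ≤ D / (n + 1) := by
        by_contra! h
        rw [Nat.lt_one_iff.1 h] at hD
        omega
      have h4 : D % (n + 1) = 0 → 2 ≤ D / (n + 1) := by
        intro h
        by_contra! h'
        rw [show D / (n + 1) = 1 by omega] at hD
        omega
      have h5 : D / (n + 1) ≤ 2 * p + 2 := by
        have := Nat.lt_of_mul_lt_mul_left (a := n + 1) (b := D / (n + 1)) (c := 2 * p + 3) (by
          rw [show (n + 1) * (2 * p + 4) = (n + 1) * (2 * p + 3) + (n + 1) by ring] at hN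
          omega)
        omega
      obtain ⟨h6, h7, h8⟩ := ht h3 h4 h5
      refine ⟨h6, fun h => ?_⟩
      by_cases h9 : D % (n + 1) = 0
      · have := ((hs (by omega)).2 h5).1 h9 (h4 h9)
        rw [h, h7 h9, mul_add_one] at this
        omega
      · exact h8 h9 (h ▸ ((hs (by omega)).2 h5).2 h9))
  refine ⟨S, hS, hS'.trans ?_⟩
  have hdiv : ∀ q, ∀ i < n + 1, ((n + 1) * q + i) / (n + 1) = q ∧ ((n + 1) * q + i) % (n + 1) = i :=
    fun q i hi => ⟨by rw [Nat.mul_add_div (by omega), Nat.div_eq_of_lt hi, add_zero],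
      by rw [Nat.mul_add_mod, Nat.mod_eq_of_lt hi]⟩
  have hblock : ∀ (F : ℕ → ℕ → ℤ) (N : ℕ),
      ∑ D ∈ range ((n + 1) * N), F (D / (n + 1)) (D % (n + 1))
        = ∑ q ∈ range N, F q 0 + ∑ q ∈ range N, ∑ i ∈ range n, F q (i + 1) := by
    intro F N
    rw [sum_range_mul, ← sum_add_distrib]
    refine sum_congr rfl fun q _ => ?_
    rw [add_comm (F q 0), ← sum_range_succ']
    refine sum_congr rfl fun i hi => ?_
    rw [(hdiv q i (mem_range.1 hi)).1, (hdiv q i (mem_range.1 hi)).2]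
  have hP : ∑ D ∈ range (2 * (n + 1) * (p + 2) + 1), u (D / (n + 1)) (D % (n + 1))
      = (4 * p + 4) * (r 0 + r (2 * (n + 1))) + 2 * r (n + 1) + ∑ q ∈ range (2 * p + 1), t₀ q
        + n * ∑ q ∈ range (2 * (p + 1) + 1), t₁ q + n * t₁ (2 * p + 2)
        + (2 * p + 3) * ∑ i ∈ range n, r (i + 1) + ∑ i ∈ range n, r (n + 1 + (i + 1)) := by
    have h1 := hdiv (2 * p + 4) 0 (by omega)
    rw [add_zero] at h1
    rw [hN, sum_range_succ, hblock, h1.1, h1.2, add_right_comm,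
      ← sum_range_succ (fun q => u q 0)]
    have h2 : ∑ q ∈ range (2 * p + 4 + 1), u q 0 = (4 * p + 4) * (r 0 + r (2 * (n + 1)))
        + 2 * r (n + 1) + ∑ q ∈ range (2 * p + 1), t₀ q := by
      rw [sum_range_succ, sum_range_succ, sum_range_succ', sum_range_succ',
        sum_congr rfl fun q hq => show u (q + 1 + 1) 0 = t₀ q + (r 0 + r (2 * (n + 1))) by
          have := mem_range.1 hq
          simp [hu, show q + 1 + 1 ≤ 2 * p + 2 by omega]]
      simp [hu, sum_add_distrib]
      ring
    have h3 : ∑ q ∈ range (2 * p + 4), ∑ i ∈ range n, u q (i + 1)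
        = n * ∑ q ∈ range (2 * (p + 1) + 1), t₁ q + n * t₁ (2 * p + 2)
        + (2 * p + 3) * ∑ i ∈ range n, r (i + 1) + ∑ i ∈ range n, r (n + 1 + (i + 1)) := by
      rw [sum_range_succ, sum_congr rfl fun q hq => show ∑ i ∈ range n, u q (i + 1)
          = n * t₁ q + ∑ i ∈ range n, r (i + 1) by
        have := mem_range.1 hq
        simp [hu, show q ≤ 2 * p + 2 by omega, sum_add_distrib]]
      simp [hu, sum_add_distrib, ← mul_sum, show 2 * (p + 1) + 1 = 2 * p + 3 by ring]
      ring
    rw [h2, h3]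
    ring
  have hQ : ∑ D ∈ Ico (n + 1 + 1) (2 * (n + 1) * (p + 2) - (n + 1)), v (D / (n + 1)) (D % (n + 1))
      = (4 * p + 2) * r (n + 1) + ∑ q ∈ range (2 * p + 1), t₀ q
        + n * (∑ q ∈ range (2 * (p + 1) + 1), t₁ q - t₁ (2 * p + 2))
        + (2 * p + 2) * ∑ i ∈ range n, r (n + 1 + (i + 1)) := by
    have h1 := hdiv 1 0 (by omega)
    rw [mul_one, add_zero] at h1
    have h2 := sum_eq_sum_Ico_succ_bot (a := n + 1) (b := 2 * (n + 1) * (p + 2) - (n + 1))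
      (by rw [hN]; ring_nf; omega) fun D => v (D / (n + 1)) (D % (n + 1))
    rw [h1.1, h1.2, show v 1 0 = 0 by simp [hv], zero_add] at h2
    rw [← h2, sum_Ico_eq_sum_range, show 2 * (n + 1) * (p + 2) - (n + 1) - (n + 1)
      = (n + 1) * (2 * p + 1 + 1) by
        rw [hN, show 2 * p + 4 = 2 * p + 1 + 1 + 1 + 1 by ring]
        simp only [mul_add_one (n + 1)]
        omega]
    simp only [Nat.add_div_left _ n.succ_pos, Nat.add_mod_left]
    rw [hblock fun q i => v (q + 1) i, sum_range_succ']
    simp [hv, sum_add_distrib, ← mul_sum, show 2 * (p + 1) + 1 = 2 * p + 1 + 1 + 1 by ring,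
      sum_range_succ _ (2 * p + 1 + 1)]
    ring
  have hr' : r 0 + ∑ i ∈ range n, r (i + 1) + r (n + 1) + ∑ i ∈ range n, r (n + 1 + (i + 1))
      + r (2 * (n + 1)) = 0 := by
    rw [← hr, sum_range_succ, show 2 * (n + 1) = (n + 1) + (n + 1) by ring, sum_range_add,
      sum_range_succ', sum_range_succ' (fun i => r (n + 1 + i))]
    ring_nf
  rw [hP, hQ]
  linear_combination (2 * p + 3 : ℤ) * hr'

namespace Realizes

theorem extreme {k : ℕ} {r : ℕ → ℤ} {j q : ℕ} (hq : q ≤ 2 * j) :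
    Realizes k r j (k * q) (k * (q / 2))
      ((q / 2 : ℕ) * r (2 * k) + (q % 2 : ℕ) * r k
        + ((j : ℤ) - (q / 2 : ℕ) - (q % 2 : ℕ)) * r 0) := by
  refine (((replicate (n := q / 2) (i := 2 * k) (Or.inr le_rfl)).add
    (replicate (n := q % 2) (i := k) (Or.inr (by omega)))).add
    (replicate (n := j - q / 2 - q % 2) (i := 0) (Or.inr (by omega)))).congr (by omega) ?_ ?_ ?_
  · conv_rhs => rw [← Nat.div_add_mod q 2]
    ring
  · rw [show 2 * k - k = k by omega, Nat.sub_self, Nat.zero_sub]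
    ring
  · rw [Nat.cast_sub (by omega), Nat.cast_sub (by omega)]

theorem exists_balanced {k : ℕ} {r : ℕ → ℤ} {j q : ℕ} (hq : q ≤ 2 * j) :
    ∃ c, Realizes k r j (k * q) (k * c)
      (((j : ℤ) - (q % j : ℕ)) * r (k * (q / j)) + (q % j : ℕ) * r (k * (q / j + 1))) := by
  have hsub : ∀ x, k * x - k = k * (x - 1) := fun x => by rw [Nat.mul_sub, mul_one]
  refine ⟨(j - q % j) * (q / j - 1) + q % j * (q / j + 1 - 1),
    (balanced (c := k) (n := 2) (by omega) (by omega)).congr rfl rfl ?_ rfl⟩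
  rw [hsub, hsub]
  ring

end Realizes

theorem exists_basis_extreme (n p : ℕ) {r : ℕ → ℤ}
    (hr : ∑ i ∈ Finset.range (2 * (n + 1) + 1), r i = 0) :
    ∃ S : Finset (DegMon (n + 1) (p + 2)), IsMonomialBasis (n + 1) (p + 2) S ∧
      2 * setWeight (fun i => r i) S =
        (2 * p + 3) * (2 * (n + 1) * (p + 1) - 1) * (r 0 + r (2 * (n + 1)))
          + (2 * (n + 1) * (p + 1) + 2 * (p + 2) - 5)
            * (2 * r (n + 1) - (r 0 + r (2 * (n + 1)))) := by
  obtain ⟨S, hS, hS'⟩ := exists_basis_of_step n p hr (fun q hq => Realizes.extreme hq)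
    (fun q hq => Realizes.extreme hq)
  refine ⟨S, hS, ?_⟩
  rw [hS', sum_extreme, sum_extreme]
  push_cast
  ring

theorem exists_basis_of_balanced_step (n p : ℕ) {r : ℕ → ℤ}
    (hr : ∑ i ∈ Finset.range (2 * (n + 1) + 1), r i = 0) :
    ∃ S : Finset (DegMon (n + 1) (p + 2)), IsMonomialBasis (n + 1) (p + 2) S ∧
      2 * setWeight (fun i => r i) S =
        (2 * p + 3) * (2 * (n + 1) * (p + 1) - 1) * (r 0 + r (2 * (n + 1)))
          + (2 * (n + 1) * (p + 1) ^ 2 - 2 * (p + 2) + 3)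
            * (2 * r (n + 1) - (r 0 + r (2 * (n + 1)))) := by
  have h : ∀ j q, ∃ c, q ≤ 2 * j → Realizes (n + 1) r j ((n + 1) * q) ((n + 1) * c)
      (((j : ℤ) - (q % j : ℕ)) * r ((n + 1) * (q / j))
        + (q % j : ℕ) * r ((n + 1) * (q / j + 1))) := by
    intro j q
    by_cases hq : q ≤ 2 * j
    · exact (Realizes.exists_balanced hq).imp fun _ h _ => h
    · exact ⟨0, fun h => absurd h hq⟩
  choose c hc using h
  obtain ⟨S, hS, hS'⟩ := exists_basis_of_step n p hr (hc p) (hc (p + 1))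
  refine ⟨S, hS, ?_⟩
  have h₀ := two_mul_sum_balanced (fun i => r ((n + 1) * i)) 2 p
  have h₁ := two_mul_sum_balanced (fun i => r ((n + 1) * i)) 2 (p + 1)
  rw [mul_comm _ 2] at h₀ h₁
  simp only [Finset.sum_range_succ _ 2, Finset.sum_range_succ _ 1, Finset.sum_range_one, mul_zero,
    mul_one, mul_comm (n + 1) 2] at h₀ h₁
  rw [hS']
  push_cast at h₀ h₁ ⊢
  linear_combination (2 * n : ℤ) * h₁ + 2 * h₀

/-- Combinatorial content of Theorem 4.1. -/
theorem ribbon_semistable (k m : ℕ) (hk : 1 ≤ k) (hm : 2 ≤ m)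
    (ρ : Fin (2 * k + 1) → ℤ) (hρ : (∑ i, ρ i) = 0) :
    ∃ S : Finset (DegMon k m), IsMonomialBasis k m S ∧ setWeight ρ S ≤ 0 := by
  obtain ⟨n, rfl⟩ := Nat.exists_eq_add_of_le' hk
  obtain ⟨p, rfl⟩ := Nat.exists_eq_add_of_le' hm
  obtain ⟨r, rfl⟩ : ∃ r : ℕ → ℤ, ρ = fun i : Fin (2 * (n + 1) + 1) => r i :=
    ⟨fun i => if h : i < 2 * (n + 1) + 1 then ρ ⟨i, h⟩ else 0, by
      ext i
      simp only [i.2, dif_pos]⟩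
  rw [Fin.sum_univ_eq_sum_range] at hρ
  obtain ⟨S₀, hS₀, h₀⟩ := exists_basis_balanced n p hρ
  obtain ⟨S₁, hS₁, h₁⟩ := exists_basis_extreme n p hρ
  obtain ⟨S₂, hS₂, h₂⟩ := exists_basis_of_balanced_step n p hρ
  by_contra! hcon
  have hW₀ := hcon S₀ hS₀
  have hW₁ := hcon S₁ hS₁
  have hW₂ := hcon S₂ hS₂
  set a := r 0 + r (2 * (n + 1))
  set b := r (n + 1)
  generalize setWeight (fun i : Fin (2 * (n + 1) + 1) => r i) S₀ = W₀ at *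
  generalize setWeight (fun i : Fin (2 * (n + 1) + 1) => r i) S₁ = W₁ at *
  generalize setWeight (fun i : Fin (2 * (n + 1) + 1) => r i) S₂ = W₂ at *
  have hn : (0 : ℤ) ≤ n := by positivity
  have hp : (0 : ℤ) ≤ p := by positivity
  have hle₁ := slope_extreme_le hn hp
  have hle₂ := le_slope_balanced hn hp
  set K : ℤ := 2 * (n + 1) * (p + 1) - 1 with hK
  have hKpos : 0 < K := by
    rw [hK]
    nlinarith [mul_nonneg hn hp]
  set Z : ℤ := (2 * n + 1) * ((p + 2) * (p + 1)) + 4 * K with hZ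
  have hZpos : 0 < Z := by positivity
  have hneg : Z * a + 2 * K * (2 * b - a) < 0 := by
    have : 0 < 2 * (2 * (n : ℤ) + 1) * W₀ := by positivity
    linear_combination this + h₀
  have hneg' := mul_neg_of_pos_of_neg (show 0 < (2 * p + 3) * K by positivity) hneg
  rcases le_total 0 (2 * b - a) with h | h
  · have h3 := mul_nonneg (sub_nonneg.2 hle₁) h
    have h4 : 0 < Z * (2 * W₁) := by positivity
    rw [h₁] at h4
    linarith
  · have h3 := mul_nonpos_of_nonneg_of_nonpos (sub_nonneg.2 hle₂) h
    have h4 : 0 < Z * (2 * W₂) := by positivity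
    rw [h₂] at h4
    linarith

end
end

section
/- For all integer weights λ_1,…,λ_k and ν_1,…,ν_k satisfying Σ_{i=1}^k (λ_i + ν_i) = 0, there exists a χ-basis of nonpositive ρ-weight. (Lemma 4.11.) -/
/-!
Lemma 4.11: for all integer weights `λ₁,…,λ_k, ν₁,…,ν_k` with `Σ (λᵢ + νᵢ) = 0`, there
exists a χ-basis of nonpositive ρ-weight.  A degree-`m` monomial in `x₁,…,x_k,y₁,…,y_k`
is encoded as a pair `(a, b)` of exponent functions `Fin k → ℕ` (index `i : Fin k`
standing for the variable with label `i + 1`) with `Σ (a i + b i) = m`; its weighted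
degree is `Σ (i+1)·(a i − b i)`.  A χ-basis is a set of `2k(m−1) − 1` such monomials,
each containing both an `x`-factor and a `y`-factor, whose weighted degrees are exactly
the integers from `−(k(m−1)−1)` to `k(m−1)−1`, each occurring exactly once.
-/

/-- The weighted degree `Σ_{i=1}^k i·(a(i) − b(i))` of a monomial `(a, b)`. -/
def wdeg (k : ℕ) (p : (Fin k → ℕ) × (Fin k → ℕ)) : ℤ :=
  ∑ i : Fin k, ((i : ℤ) + 1) * ((p.1 i : ℤ) - (p.2 i : ℤ))

/-- The ρ-weight `Σ_{i=1}^k (a(i)·λᵢ + b(i)·νᵢ)` of a monomial `(a, b)`. -/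
def chiWt (k : ℕ) (lam nu : Fin k → ℤ) (p : (Fin k → ℕ) × (Fin k → ℕ)) : ℤ :=
  ∑ i : Fin k, ((p.1 i : ℤ) * lam i + (p.2 i : ℤ) * nu i)

/-- A χ-basis: `2k(m−1) − 1` degree-`m` monomials, each with both an `x`- and a
`y`-factor, whose weighted degrees are exactly the integers in
`[−(k(m−1)−1), k(m−1)−1]`, each occurring exactly once. -/
def IsChiBasis (k m : ℕ) (S : Finset ((Fin k → ℕ) × (Fin k → ℕ))) : Prop :=
  S.card = 2 * k * (m - 1) - 1 ∧
  (∀ p ∈ S, (∑ i : Fin k, (p.1 i + p.2 i)) = m ∧ p.1 ≠ 0 ∧ p.2 ≠ 0) ∧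
  (∀ p ∈ S, -((k : ℤ) * ((m : ℤ) - 1) - 1) ≤ wdeg k p ∧
      wdeg k p ≤ (k : ℤ) * ((m : ℤ) - 1) - 1) ∧
  (∀ d : ℤ, -((k : ℤ) * ((m : ℤ) - 1) - 1) ≤ d → d ≤ (k : ℤ) * ((m : ℤ) - 1) - 1 →
      (S.filter (fun p => wdeg k p = d)).card = 1)

/-- Monomials of degree `m` with at least `u` factors `x` and at least `v` factors `y`. -/
def IsMono (k m u v : ℕ) (p : (Fin k → ℕ) × (Fin k → ℕ)) : Prop :=
  (∑ i, p.1 i) + (∑ i, p.2 i) = m ∧ u ≤ ∑ i, p.1 i ∧ v ≤ ∑ i, p.2 i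

/-- There are monomials of the `n` weighted degrees `c, c - 1, …, c - n + 1` with average
ρ-weight at most `w`. -/
def HasChain (k : ℕ) (lam nu : Fin k → ℤ) (m u v : ℕ) (c : ℤ) (n : ℕ) (w : ℚ) : Prop :=
  ∃ f : ℕ → (Fin k → ℕ) × (Fin k → ℕ),
    (∀ i < n, IsMono k m u v (f i) ∧ wdeg k (f i) = c - i) ∧
    ∑ i ∈ Finset.range n, (chiWt k lam nu (f i) : ℚ) ≤ n * w

/-- The weights `f`, indexed by all natural numbers and cast to `ℚ`. -/
def extendWt {k : ℕ} (f : Fin k → ℤ) (i : ℕ) : ℚ := if h : i < k then (f ⟨i, h⟩ : ℚ) else 0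

/-- The variable `x` with label `i + 1`. -/
def xVar (k i : ℕ) : (Fin k → ℕ) × (Fin k → ℕ) := (fun t => if t.val = i then 1 else 0, 0)

/-- The variable `y` with label `i + 1`. -/
def yVar (k i : ℕ) : (Fin k → ℕ) × (Fin k → ℕ) := (0, fun t => if t.val = i then 1 else 0)

section Monomials

variable {k : ℕ} {lam nu : Fin k → ℤ}

lemma wdeg_add (p q : (Fin k → ℕ) × (Fin k → ℕ)) : wdeg k (p + q) = wdeg k p + wdeg k q := by
  simp only [wdeg, ← Finset.sum_add_distrib]
  refine Finset.sum_congr rfl fun i _ => ?_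
  simp only [Prod.fst_add, Prod.snd_add, Pi.add_apply]
  push_cast
  ring

lemma chiWt_add (p q : (Fin k → ℕ) × (Fin k → ℕ)) :
    chiWt k lam nu (p + q) = chiWt k lam nu p + chiWt k lam nu q := by
  simp only [chiWt, ← Finset.sum_add_distrib]
  refine Finset.sum_congr rfl fun i _ => ?_
  simp only [Prod.fst_add, Prod.snd_add, Pi.add_apply]
  push_cast
  ring

lemma IsMono.add {m u v m' u' v' : ℕ} {p q : (Fin k → ℕ) × (Fin k → ℕ)}
    (hp : IsMono k m u v p) (hq : IsMono k m' u' v' q) :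
    IsMono k (m + m') (u + u') (v + v') (p + q) := by
  unfold IsMono at *
  simp only [Prod.fst_add, Prod.snd_add, Pi.add_apply, Finset.sum_add_distrib]
  omega

lemma IsMono.mono {m u v u' v' : ℕ} {p : (Fin k → ℕ) × (Fin k → ℕ)}
    (hp : IsMono k m u v p) (hu : u' ≤ u) (hv : v' ≤ v) : IsMono k m u' v' p :=
  ⟨hp.1, hu.trans hp.2.1, hv.trans hp.2.2⟩

lemma sum_ite_val_eq {M : Type*} [AddCommMonoid M] {i : ℕ} (hi : i < k) (g : Fin k → M) :
    ∑ t : Fin k, (if t.val = i then g t else 0) = g ⟨i, hi⟩ := by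
  rw [Finset.sum_eq_single ⟨i, hi⟩]
  · simp
  · intro b _ hb
    rw [if_neg fun h => hb (Fin.ext h)]
  · simp

lemma isMono_xVar {i : ℕ} (hi : i < k) : IsMono k 1 1 0 (xVar k i) := by
  simp [IsMono, xVar, sum_ite_val_eq hi]

lemma isMono_yVar {i : ℕ} (hi : i < k) : IsMono k 1 0 1 (yVar k i) := by
  simp [IsMono, yVar, sum_ite_val_eq hi]

lemma wdeg_xVar {i : ℕ} (hi : i < k) : wdeg k (xVar k i) = i + 1 := by
  simp [wdeg, xVar, sum_ite_val_eq hi]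

lemma wdeg_yVar {i : ℕ} (hi : i < k) : wdeg k (yVar k i) = -(i + 1) := by
  simp only [wdeg, yVar, Pi.zero_apply, Nat.cast_zero, zero_sub, Nat.cast_ite, Nat.cast_one,
    mul_neg, mul_ite, mul_one, mul_zero, Finset.sum_neg_distrib]
  rw [sum_ite_val_eq hi]

lemma chiWt_xVar {i : ℕ} (hi : i < k) : (chiWt k lam nu (xVar k i) : ℚ) = extendWt lam i := by
  simp [chiWt, xVar, sum_ite_val_eq hi, extendWt, hi]

lemma chiWt_yVar {i : ℕ} (hi : i < k) : (chiWt k lam nu (yVar k i) : ℚ) = extendWt nu i := by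
  simp [chiWt, yVar, sum_ite_val_eq hi, extendWt, hi]

lemma sum_extendWt (h : (∑ i : Fin k, (lam i + nu i)) = 0) :
    ∑ i ∈ Finset.range k, (extendWt lam i + extendWt nu i) = 0 := by
  rw [Finset.sum_range]
  have h' : ((∑ i : Fin k, (lam i + nu i) : ℤ) : ℚ) = 0 := by rw [h]; simp
  rw [← h']
  push_cast
  refine Finset.sum_congr rfl fun i _ => ?_
  simp [extendWt]

end Monomials

namespace HasChain

variable {k : ℕ} {lam nu : Fin k → ℤ}

lemma mono {m u v n : ℕ} {c : ℤ} {w : ℚ} (H : HasChain k lam nu m u v c n w)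
    {u' v' : ℕ} {w' : ℚ} (hu : u' ≤ u) (hv : v' ≤ v) (hw : w ≤ w') :
    HasChain k lam nu m u' v' c n w' := by
  obtain ⟨f, hf, hs⟩ := H
  exact ⟨f, fun i hi => ⟨(hf i hi).1.mono hu hv, (hf i hi).2⟩, hs.trans (by gcongr)⟩

lemma single {m u v : ℕ} {c : ℤ} {w : ℚ} (p : (Fin k → ℕ) × (Fin k → ℕ))
    (hp : IsMono k m u v p) (hd : wdeg k p = c) (hw : (chiWt k lam nu p : ℚ) ≤ w) :
    HasChain k lam nu m u v c 1 w :=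
  ⟨fun _ => p, fun i hi => ⟨hp, by simp [hd, Nat.lt_one_iff.mp hi]⟩, by simpa using hw⟩

lemma append {m u v n₁ n₂ n : ℕ} {c₁ c₂ : ℤ} {w₁ w₂ w : ℚ}
    (H₁ : HasChain k lam nu m u v c₁ n₁ w₁) (H₂ : HasChain k lam nu m u v c₂ n₂ w₂)
    (hc : c₂ = c₁ - n₁) (hn : n = n₁ + n₂) (hw : n₁ * w₁ + n₂ * w₂ ≤ n * w) :
    HasChain k lam nu m u v c₁ n w := by
  obtain ⟨f, hf, hfs⟩ := H₁
  obtain ⟨g, hg, hgs⟩ := H₂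
  refine ⟨fun i => if i < n₁ then f i else g (i - n₁), fun i hi => ?_, ?_⟩
  · by_cases h : i < n₁
    · simpa [h] using hf i h
    · have := hg (i - n₁) (by omega)
      simp only [h, if_false]
      refine ⟨this.1, ?_⟩
      rw [this.2, hc]
      push_cast [Nat.cast_sub (not_lt.mp h)]
      ring
  · rw [hn, Finset.sum_range_add]
    have e₁ : ∑ i ∈ Finset.range n₁,
        (chiWt k lam nu (if i < n₁ then f i else g (i - n₁)) : ℚ)
          = ∑ i ∈ Finset.range n₁, (chiWt k lam nu (f i) : ℚ) :=
      Finset.sum_congr rfl fun i hi => by rw [if_pos (Finset.mem_range.mp hi)]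
    have e₂ : ∑ i ∈ Finset.range n₂,
        (chiWt k lam nu (if n₁ + i < n₁ then f (n₁ + i) else g (n₁ + i - n₁)) : ℚ)
          = ∑ i ∈ Finset.range n₂, (chiWt k lam nu (g i) : ℚ) :=
      Finset.sum_congr rfl fun i _ => by simp
    rw [e₁, e₂, ← hn]
    linarith

lemma append_average {m u v n₁ n₂ n : ℕ} {c₁ c₂ : ℤ} {w₁ w₂ : ℚ}
    (H₁ : HasChain k lam nu m u v c₁ n₁ w₁) (H₂ : HasChain k lam nu m u v c₂ n₂ w₂)
    (hc : c₂ = c₁ - n₁) (hn : n = n₁ + n₂) (hpos : 0 < n) :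
    HasChain k lam nu m u v c₁ n ((n₁ * w₁ + n₂ * w₂) / n) :=
  append H₁ H₂ hc hn (by rw [mul_div_cancel₀ _ (by positivity)])

/-- Two chains indexed by `0, …, n` and `0, …, p` combine along a monotone lattice path of the
grid; on average over the uniformly random path, every row and every column is visited equally
often. -/
lemma exists_merge {m u v m' u' v' : ℕ} (n p : ℕ) (c c' : ℤ)
    (f g : ℕ → (Fin k → ℕ) × (Fin k → ℕ))
    (hf : ∀ i < n + 1, IsMono k m u v (f i) ∧ wdeg k (f i) = c - i)
    (hg : ∀ i < p + 1, IsMono k m' u' v' (g i) ∧ wdeg k (g i) = c' - i) :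
    HasChain k lam nu (m + m') (u + u') (v + v') (c + c') (n + p + 1)
      ((∑ i ∈ Finset.range (n + 1), (chiWt k lam nu (f i) : ℚ)) / (n + 1) +
        (∑ i ∈ Finset.range (p + 1), (chiWt k lam nu (g i) : ℚ)) / (p + 1)) := by
  have shift : ∀ {m u v n : ℕ} {c : ℤ} {f : ℕ → (Fin k → ℕ) × (Fin k → ℕ)},
      (∀ i < n + 1 + 1, IsMono k m u v (f i) ∧ wdeg k (f i) = c - i) →
      ∀ i < n + 1, IsMono k m u v (f (i + 1)) ∧ wdeg k (f (i + 1)) = c - 1 - i := by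
    intro m u v n c f hf i hi
    refine ⟨(hf (i + 1) (by omega)).1, ?_⟩
    rw [(hf (i + 1) (by omega)).2]
    push_cast
    ring
  have head : ∀ {n p : ℕ} {c c' : ℤ} {f g : ℕ → (Fin k → ℕ) × (Fin k → ℕ)},
      (∀ i < n + 1, IsMono k m u v (f i) ∧ wdeg k (f i) = c - i) →
      (∀ i < p + 1, IsMono k m' u' v' (g i) ∧ wdeg k (g i) = c' - i) →
      HasChain k lam nu (m + m') (u + u') (v + v') (c + c') 1
        (chiWt k lam nu (f 0) + chiWt k lam nu (g 0)) := by
    intro n p c c' f g hf hg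
    refine single (f 0 + g 0) ((hf 0 (by omega)).1.add (hg 0 (by omega)).1) ?_ ?_
    · rw [wdeg_add, (hf 0 (by omega)).2, (hg 0 (by omega)).2]
      simp
    · rw [chiWt_add]
      push_cast
      rfl
  induction n generalizing p c c' f g with
  | zero =>
    refine ⟨fun i => f 0 + g i, fun i hi => ⟨(hf 0 (by omega)).1.add (hg i (by omega)).1, ?_⟩, ?_⟩
    · rw [wdeg_add, (hf 0 (by omega)).2, (hg i (by omega)).2]
      push_cast
      ring
    · simp only [chiWt_add, Int.cast_add, Finset.sum_add_distrib, zero_add]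
      simp only [Finset.sum_const, Finset.card_range, nsmul_eq_mul, Finset.sum_range_one]
      have : (p : ℚ) + 1 ≠ 0 := by positivity
      push_cast
      apply le_of_eq
      field_simp
      ring
  | succ n ihn =>
    induction p generalizing c c' f g with
    | zero =>
      refine ⟨fun i => f i + g 0, fun i hi =>
        ⟨(hf i (by omega)).1.add (hg 0 (by omega)).1, ?_⟩, ?_⟩
      · rw [wdeg_add, (hf i (by omega)).2, (hg 0 (by omega)).2]
        push_cast
        ring
      · simp only [chiWt_add, Int.cast_add, Finset.sum_add_distrib, zero_add, add_zero]
        simp only [Finset.sum_const, Finset.card_range, nsmul_eq_mul, Finset.sum_range_one]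
        have : (n : ℚ) + 1 + 1 ≠ 0 := by positivity
        push_cast
        apply le_of_eq
        field_simp
        ring
    | succ p ihp =>
      have H₁ := ihn (p + 1) (c - 1) c' (fun i => f (i + 1)) g (shift hf) hg
      have H₂ := ihp c (c' - 1) f (fun i => g (i + 1)) hf (shift hg)
      have hd := head hf hg
      rw [Finset.sum_range_succ' (fun i => (chiWt k lam nu (f i) : ℚ)) (n + 1),
        Finset.sum_range_succ' (fun i => (chiWt k lam nu (g i) : ℚ)) (p + 1)] at *
      generalize ∑ i ∈ Finset.range (n + 1), (chiWt k lam nu (f (i + 1)) : ℚ) = F at *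
      generalize ∑ i ∈ Finset.range (p + 1), (chiWt k lam nu (g (i + 1)) : ℚ) = G at *
      generalize (chiWt k lam nu (f 0) : ℚ) = a at *
      generalize (chiWt k lam nu (g 0) : ℚ) = b at *
      push_cast at *
      set W : ℚ := (F + a) / (n + 1 + 1) + (G + b) / (p + 1 + 1) with hW
      have key : ((n : ℚ) + 1) * (a + b + (n + p + 2) * (F / (n + 1) + (G + b) / (p + 1 + 1))) +
          (p + 1) * (a + b + (n + p + 2) * ((F + a) / (n + 1 + 1) + G / (p + 1))) =
          (n + p + 2) * ((n + p + 3) * W) := by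
        have h₁ : (n : ℚ) + 1 ≠ 0 := by positivity
        have h₂ : (n : ℚ) + 1 + 1 ≠ 0 := by positivity
        have h₃ : (p : ℚ) + 1 ≠ 0 := by positivity
        have h₄ : (p : ℚ) + 1 + 1 ≠ 0 := by positivity
        rw [hW]
        field_simp
        ring
      rcases le_or_gt (a + b + ((n : ℚ) + p + 2) * (F / (n + 1) + (G + b) / (p + 1 + 1)))
        ((n + p + 3) * W) with h | h
      · refine append hd H₁ (by push_cast; ring) (by omega) ?_
        push_cast
        linarith
      · refine append hd H₂ (by push_cast; ring) (by omega) ?_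
        have h' : a + b + ((n : ℚ) + p + 2) * ((F + a) / (n + 1 + 1) + G / (p + 1)) ≤
            (n + p + 3) * W := by
          have hn : (0 : ℚ) < n + 1 := by positivity
          have hp : (0 : ℚ) < p + 1 := by positivity
          have := mul_lt_mul_of_pos_left h hn
          refine le_of_mul_le_mul_left ?_ hp
          linarith
        push_cast
        linarith

lemma merge {m u v m' u' v' n₁ n₂ n : ℕ} {c₁ c₂ c : ℤ} {w₁ w₂ w : ℚ}
    (H₁ : HasChain k lam nu m u v c₁ n₁ w₁) (H₂ : HasChain k lam nu m' u' v' c₂ n₂ w₂)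
    (h₁ : 0 < n₁) (h₂ : 0 < n₂) (hn : n + 1 = n₁ + n₂) (hc : c = c₁ + c₂) (hw : w₁ + w₂ ≤ w) :
    HasChain k lam nu (m + m') (u + u') (v + v') c n w := by
  obtain ⟨f, hf, hfs⟩ := H₁
  obtain ⟨g, hg, hgs⟩ := H₂
  obtain ⟨a, rfl⟩ : ∃ a, n₁ = a + 1 := ⟨n₁ - 1, by omega⟩
  obtain ⟨b, rfl⟩ : ∃ b, n₂ = b + 1 := ⟨n₂ - 1, by omega⟩
  obtain rfl : n = a + b + 1 := by omega
  subst hc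
  refine (exists_merge a b c₁ c₂ f g hf hg).mono le_rfl le_rfl (le_trans (add_le_add ?_ ?_) hw)
  · rw [div_le_iff₀ (by positivity)]
    push_cast at hfs
    linarith
  · rw [div_le_iff₀ (by positivity)]
    push_cast at hgs
    linarith

lemma xVars {j n : ℕ} {c : ℤ} (h : j + n ≤ k) (hn : 0 < n) (hc : c = j + n) :
    HasChain k lam nu 1 1 0 c n ((∑ t ∈ Finset.range n, extendWt lam (j + t)) / n) := by
  refine ⟨fun t => xVar k (j + (n - 1 - t)), fun i hi => ⟨isMono_xVar (by omega), ?_⟩, ?_⟩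
  · rw [wdeg_xVar (by omega)]
    omega
  · have hn' : (n : ℚ) ≠ 0 := by positivity
    rw [mul_div_cancel₀ _ hn', ← Finset.sum_range_reflect]
    refine (Finset.sum_congr rfl fun i hi => ?_).le
    rw [Finset.mem_range] at hi
    beta_reduce
    rw [show n - 1 - (n - 1 - i) = i by omega]
    exact chiWt_xVar (by omega)

lemma yVars {j n : ℕ} {c : ℤ} (h : j + n ≤ k) (hn : 0 < n) (hc : c = -(j + 1)) :
    HasChain k lam nu 1 0 1 c n ((∑ t ∈ Finset.range n, extendWt nu (j + t)) / n) := by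
  refine ⟨fun t => yVar k (j + t), fun i hi => ⟨isMono_yVar (by omega), ?_⟩, ?_⟩
  · rw [wdeg_yVar (by omega)]
    omega
  · have hn' : (n : ℚ) ≠ 0 := by positivity
    rw [mul_div_cancel₀ _ hn']
    refine (Finset.sum_congr rfl fun i hi => ?_).le
    rw [Finset.mem_range] at hi
    exact chiWt_yVar (by omega)

/-- The quadratic monomials of all weighted degrees from `2k` to `-2k`. -/
lemma quadratic (hk : 2 ≤ k) (h : (∑ i : Fin k, (lam i + nu i)) = 0) :
    HasChain k lam nu 2 0 0 (2 * k) (4 * k + 1) 0 := by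
  have hs := sum_extendWt h
  set L := extendWt lam with hL
  set N := extendWt nu with hN
  obtain ⟨K, rfl⟩ : ∃ K, k = K + 1 := ⟨k - 1, by omega⟩
  obtain ⟨a, ha, haw⟩ : ∃ a ∈ Finset.range K,
      L (a + 1) + N a ≤ (∑ i ∈ Finset.range K, (L (i + 1) + N i)) / K := by
    refine Finset.exists_le_of_sum_le (Finset.nonempty_range_iff.mpr (by omega)) ?_
    have : (K : ℚ) ≠ 0 := by norm_cast; omega
    simp only [Finset.sum_const, Finset.card_range, nsmul_eq_mul]
    rw [mul_div_cancel₀ _ this]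
  obtain ⟨b, hb, hbw⟩ : ∃ b ∈ Finset.range K,
      L b + N (b + 1) ≤ (∑ i ∈ Finset.range K, (L i + N (i + 1))) / K := by
    refine Finset.exists_le_of_sum_le (Finset.nonempty_range_iff.mpr (by omega)) ?_
    have : (K : ℚ) ≠ 0 := by norm_cast; omega
    simp only [Finset.sum_const, Finset.card_range, nsmul_eq_mul]
    rw [mul_div_cancel₀ _ this]
  obtain ⟨z, hz, hzw⟩ := Finset.exists_min_image (Finset.range (K + 1)) (fun i => L i + N i)
    (Finset.nonempty_range_iff.mpr (by omega))
  rw [Finset.mem_range] at ha hb hz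
  have z₀ := hzw 0 (by simp)
  have z₁ := hzw K (by simp)
  have z₂ : L z + N z ≤ 0 := by
    have := Finset.card_nsmul_le_sum _ _ _ hzw
    rw [hs] at this
    simp only [Finset.card_range, nsmul_eq_mul] at this
    exact nonpos_of_mul_nonpos_right this (by positivity)
  have gaps : (L (a + 1) + N a) + (L b + N (b + 1)) + (L z + N z) ≤ 0 := by
    have hK : (0 : ℚ) < K := by norm_cast; omega
    rw [le_div_iff₀ hK] at haw hbw
    have e : (∑ i ∈ Finset.range K, (L (i + 1) + N i)) + ∑ i ∈ Finset.range K, (L i + N (i + 1))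
        = -((L 0 + N 0) + (L K + N K)) := by
      have h₁ := hs
      have h₂ := hs
      rw [Finset.sum_range_succ] at h₁
      rw [Finset.sum_range_succ'] at h₂
      simp only [Finset.sum_add_distrib] at *
      linarith
    refine nonpos_of_mul_nonpos_left (b := (K : ℚ)) ?_ hK
    rcases Nat.lt_or_ge K 2 with h2 | h2
    · obtain rfl : K = 1 := by omega
      simp only [Finset.sum_range_succ, Finset.sum_range_zero] at hs
      norm_num at *
      linarith
    · have : (2 : ℚ) ≤ K := by exact_mod_cast h2
      nlinarith
  have X := xVars (k := K + 1) (lam := lam) (nu := nu) (j := 0) (n := K + 1) (by omega) (by omega)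
    rfl
  have Y := yVars (k := K + 1) (lam := lam) (nu := nu) (j := 0) (n := K + 1) (by omega) (by omega)
    rfl
  have XX := (merge (n := 2 * K + 1) X X (by omega) (by omega) (by omega) rfl le_rfl).mono
    (Nat.zero_le _) (Nat.zero_le _) le_rfl
  have YY := (merge (n := 2 * K + 1) Y Y (by omega) (by omega) (by omega) rfl le_rfl).mono
    (Nat.zero_le _) (Nat.zero_le _) le_rfl
  have pt : ∀ i j : ℕ, i < K + 1 → j < K + 1 →
      HasChain (K + 1) lam nu 2 0 0 ((i : ℤ) - j) 1 (L i + N j) := by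
    intro i j hi hj
    refine single (xVar _ i + yVar _ j) (((isMono_xVar hi).add (isMono_yVar hj)).mono
      (Nat.zero_le _) (Nat.zero_le _)) ?_ ?_
    · rw [wdeg_add, wdeg_xVar hi, wdeg_yVar hj]; ring
    · rw [chiWt_add]
      push_cast
      rw [chiWt_xVar hi, chiWt_yVar hj]
  have T₁ := append_average (pt b (b + 1) (by omega) (by omega)) YY (by push_cast; ring) rfl
    (by omega)
  have T₂ := append_average (pt z z (by omega) (by omega)) T₁ (by push_cast; ring) rfl (by omega)
  have T₃ := append_average (pt (a + 1) a (by omega) (by omega)) T₂ (by push_cast; ring) rfl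
    (by omega)
  have T₄ := append (n := 4 * (K + 1) + 1) (w := 0) XX T₃ (by push_cast; ring) (by omega) (by
    rw [mul_div_cancel₀ _ (by positivity), mul_div_cancel₀ _ (by positivity),
      mul_div_cancel₀ _ (by positivity)]
    simp only [zero_add, ← hL, ← hN]
    have hK : ((K + 1 : ℕ) : ℚ) ≠ 0 := by positivity
    rw [Finset.sum_add_distrib] at hs
    have : (∑ t ∈ Finset.range (K + 1), N t) = -∑ t ∈ Finset.range (K + 1), L t := by linarith
    rw [this, neg_div]
    linarith)
  convert T₄ using 1
  push_cast
  ring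

/-- A mixed cubic monomial of weighted degree zero and nonpositive weight. -/
lemma cubic_zero (hk : 3 ≤ k) (h : (∑ i : Fin k, (lam i + nu i)) = 0) :
    HasChain k lam nu 3 1 1 0 1 0 := by
  have hs := sum_extendWt h
  set L := extendWt lam with hL
  set N := extendWt nu with hN
  set T : ℕ → ℚ := fun n => ∑ i ∈ Finset.range n, (L i + N i) with hT
  obtain ⟨n, hn, hnk, hw⟩ : ∃ n, 2 ≤ n ∧ n < k ∧ 2 * T n + n * (L n + N n) ≤ 0 := by
    by_contra! H
    have pos : ∀ n, 3 ≤ n → n ≤ k → 0 < T n := by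
      intro n hn
      induction n, hn using Nat.le_induction with
      | base =>
        intro _
        have := H 2 le_rfl (by omega)
        have e : T 3 = T 2 + (L 2 + N 2) := Finset.sum_range_succ _ _
        push_cast at this
        linarith
      | succ n hn ih =>
        intro hnk
        have h₁ := H n (by omega) (by omega)
        have h₂ := ih (by omega)
        have e : T (n + 1) = T n + (L n + N n) := Finset.sum_range_succ _ _
        have hn' : (3 : ℚ) ≤ n := by exact_mod_cast hn
        rw [e]
        by_contra! h₃
        nlinarith
    exact (pos k hk le_rfl).ne' hs
  obtain ⟨t, ht, htw⟩ : ∃ t ∈ Finset.range n,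
      (L t + L (n - 1 - t) + N n) + (N t + N (n - 1 - t) + L n) ≤ 0 := by
    refine Finset.exists_le_of_sum_le (Finset.nonempty_range_iff.mpr (by omega)) ?_
    have e₁ := Finset.sum_range_reflect L n
    have e₂ := Finset.sum_range_reflect N n
    simp only [hT, Finset.sum_add_distrib] at hw
    simp only [Finset.sum_add_distrib, Finset.sum_const, Finset.card_range, nsmul_eq_mul, e₁, e₂]
    linarith
  rw [Finset.mem_range] at ht
  have k₁ : t < k := by omega
  have k₂ : n - 1 - t < k := by omega
  rcases le_total (L t + L (n - 1 - t) + N n) 0 with h₀ | h₀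
  · refine single (xVar _ t + xVar _ (n - 1 - t) + yVar _ n)
      ((((isMono_xVar k₁).add (isMono_xVar k₂)).add (isMono_yVar hnk)).mono (by omega) (by omega))
      ?_ ?_
    · rw [wdeg_add, wdeg_add, wdeg_xVar k₁, wdeg_xVar k₂, wdeg_yVar hnk]
      omega
    · rw [chiWt_add, chiWt_add]
      push_cast
      rw [chiWt_xVar k₁, chiWt_xVar k₂, chiWt_yVar hnk]
      exact h₀
  · refine single (yVar _ t + yVar _ (n - 1 - t) + xVar _ n)
      ((((isMono_yVar k₁).add (isMono_yVar k₂)).add (isMono_xVar hnk)).mono (by omega) (by omega))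
      ?_ ?_
    · rw [wdeg_add, wdeg_add, wdeg_yVar k₁, wdeg_yVar k₂, wdeg_xVar hnk]
      omega
    · rw [chiWt_add, chiWt_add]
      push_cast
      rw [chiWt_yVar k₁, chiWt_yVar k₂, chiWt_xVar hnk]
      linarith

lemma cubic_zero_of_two {lam nu : Fin 2 → ℤ} (h : (∑ i : Fin 2, (lam i + nu i)) = 0) :
    HasChain 2 lam nu 3 1 1 0 1 ((extendWt lam 0 + extendWt nu 0) / 2) := by
  have hs := sum_extendWt h
  simp only [Finset.sum_range_succ, Finset.sum_range_zero] at hs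
  have k₀ : 0 < 2 := by omega
  have k₁ : 1 < 2 := by omega
  rcases le_total (extendWt lam 0 + extendWt lam 0 + extendWt nu 1)
    (extendWt nu 0 + extendWt nu 0 + extendWt lam 1) with h₀ | h₀
  · refine single (xVar _ 0 + xVar _ 0 + yVar _ 1)
      ((((isMono_xVar k₀).add (isMono_xVar k₀)).add (isMono_yVar k₁)).mono (by omega) (by omega))
      ?_ ?_
    · rw [wdeg_add, wdeg_add, wdeg_xVar k₀, wdeg_yVar k₁]
      norm_num
    · rw [chiWt_add, chiWt_add]
      push_cast
      rw [chiWt_xVar k₀, chiWt_yVar k₁]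
      linarith
  · refine single (yVar _ 0 + yVar _ 0 + xVar _ 1)
      ((((isMono_yVar k₀).add (isMono_yVar k₀)).add (isMono_xVar k₁)).mono (by omega) (by omega))
      ?_ ?_
    · rw [wdeg_add, wdeg_add, wdeg_yVar k₀, wdeg_xVar k₁]
      norm_num
    · rw [chiWt_add, chiWt_add]
      push_cast
      rw [chiWt_yVar k₀, chiWt_xVar k₁]
      linarith

lemma mixed_two (hk : 2 ≤ k) (h : (∑ i : Fin k, (lam i + nu i)) = 0) :
    HasChain k lam nu 2 1 1 (k - 1) (2 * k - 1) 0 := by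
  have hs := sum_extendWt h
  have X := xVars (k := k) (lam := lam) (nu := nu) (j := 0) (n := k) (by omega) (by omega) rfl
  have Y := yVars (k := k) (lam := lam) (nu := nu) (j := 0) (n := k) (by omega) (by omega) rfl
  refine merge X Y (by omega) (by omega) (by omega) (by push_cast; ring) (le_of_eq ?_)
  rw [← add_div, ← Finset.sum_add_distrib]
  simp [hs]

lemma mixed_three (hk : 2 ≤ k) (h : (∑ i : Fin k, (lam i + nu i)) = 0) :
    HasChain k lam nu 3 1 1 (2 * k - 1) (4 * k - 1) 0 := by
  have hs := sum_extendWt h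
  set L := extendWt lam with hL
  set N := extendWt nu with hN
  set T : ℕ → ℚ := fun n => ∑ i ∈ Finset.range n, (L i + N i) with hT
  obtain ⟨i, hi, hi₀, hi₁⟩ : ∃ i < k, 0 ≤ T i ∧ T (i + 1) ≤ 0 := by
    by_contra! H
    have pos : ∀ n < k, 0 < T (n + 1) := by
      intro n
      induction n with
      | zero => exact fun hk => H 0 hk (by simp [hT])
      | succ n ih => exact fun hk => H _ hk (ih (by omega)).le
    have := pos (k - 1) (by omega)
    rw [Nat.sub_add_cancel (by omega)] at this
    exact this.ne' hs
  obtain ⟨w, hw, hwT⟩ : ∃ w, HasChain k lam nu 3 1 1 0 1 w ∧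
      ((2 * k - 1 : ℕ) : ℚ) * (T (i + 1) / (i + 1 : ℕ) - T i / (k - i : ℕ)) + w ≤ 0 := by
    rcases Nat.lt_or_ge k 3 with h3 | h3
    · obtain rfl : k = 2 := by omega
      refine ⟨_, cubic_zero_of_two h, ?_⟩
      change T 2 = 0 at hs
      have e : T 1 = L 0 + N 0 := by simp [hT]
      rw [← e]
      interval_cases i
      · have : T 0 = 0 := by simp [hT]
        norm_num at *
        linarith
      · norm_num [hs] at *
        linarith
    · refine ⟨0, cubic_zero h3 h, ?_⟩
      have h₁ : T (i + 1) / (i + 1 : ℕ) ≤ 0 := div_nonpos_of_nonpos_of_nonneg hi₁ (by positivity)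
      have h₂ : 0 ≤ T i / (k - i : ℕ) := by positivity
      rw [add_zero]
      exact mul_nonpos_of_nonneg_of_nonpos (by positivity) (by linarith)
  have X := xVars (k := k) (lam := lam) (nu := nu) (j := 0) (n := k) (by omega) (by omega) rfl
  have Y := yVars (k := k) (lam := lam) (nu := nu) (j := 0) (n := k) (by omega) (by omega) rfl
  have Xlo := xVars (k := k) (lam := lam) (nu := nu) (j := 0) (n := i + 1) (by omega) (by omega) rfl
  have Ylo := yVars (k := k) (lam := lam) (nu := nu) (j := 0) (n := i + 1) (by omega) (by omega) rfl
  have Xhi := xVars (k := k) (lam := lam) (nu := nu) (j := i) (n := k - i) (by omega) (by omega) rfl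
  have Yhi := yVars (k := k) (lam := lam) (nu := nu) (j := i) (n := k - i) (by omega) (by omega) rfl
  have U := merge (n := 2 * k - 1) (merge (n := k) Xhi Ylo (by omega) (by omega) (by omega) rfl
    le_rfl) X (by omega) (by omega) (by omega) rfl le_rfl
  have V := merge (n := 2 * k - 1) (merge (n := k) Xlo Yhi (by omega) (by omega) (by omega) rfl
    le_rfl) Y (by omega) (by omega) (by omega) rfl le_rfl
  have U' := U.mono (u' := 1) (v' := 1) (by omega) (by omega) le_rfl
  have V' := V.mono (u' := 1) (v' := 1) (by omega) (by omega) le_rfl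
  have B := append_average (n := 2 * k) hw V' (by push_cast; ring) (by omega) (by omega)
  have C := append (n := 4 * k - 1) (w := 0) U' B (by omega) (by omega) (by
    rw [mul_div_cancel₀ _ (by norm_cast; omega)]
    simp only [zero_add, ← hL, ← hN]
    have lo : T (i + 1) = (∑ t ∈ Finset.range (i + 1), L t) + ∑ t ∈ Finset.range (i + 1), N t :=
      Finset.sum_add_distrib
    have hi' : -T i = (∑ t ∈ Finset.range (k - i), L (i + t)) +
        ∑ t ∈ Finset.range (k - i), N (i + t) := by
      rw [← Finset.sum_add_distrib]
      have := Finset.sum_range_add (fun t => L t + N t) i (k - i)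
      rw [Nat.add_sub_cancel' hi.le, hs] at this
      linarith
    have full : (∑ t ∈ Finset.range k, L t) / (k : ℚ) + (∑ t ∈ Finset.range k, N t) / (k : ℚ)
        = 0 := by
      rw [← add_div, ← Finset.sum_add_distrib, hs, zero_div]
    rw [sub_eq_add_neg, ← neg_div, lo, hi', add_div, add_div] at hwT
    linear_combination hwT + ((2 * k - 1 : ℕ) : ℚ) * full)
  convert C using 1
  omega

lemma mixed (hk : 2 ≤ k) (h : (∑ i : Fin k, (lam i + nu i)) = 0) (j : ℕ) :
    HasChain k lam nu (j + 2) 1 1 (k * (j + 1) - 1) (2 * k * (j + 1) - 1) 0 := by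
  induction j using Nat.twoStepInduction with
  | zero => simpa using mixed_two hk h
  | one =>
    convert mixed_three hk h using 1
    · push_cast; ring
    · congr 1; ring
  | more j ih _ =>
    have hpos : 0 < 2 * k * (j + 1) - 1 := by
      have : k * 1 ≤ k * (j + 1) := Nat.mul_le_mul_left _ (by omega)
      have : 2 * k * (j + 1) = 2 * (k * (j + 1)) := by ring
      omega
    refine merge ih (quadratic hk h) hpos (by omega) ?_ ?_ (by simp)
    · have : 2 * k * (j + 2 + 1) = 2 * k * (j + 1) + 4 * k := by ring
      omega
    · push_cast; ring

end HasChain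

/-- Lemma 4.11. -/
theorem chi_basis_nonpositive (k m : ℕ) (hk : 2 ≤ k) (hm : 2 ≤ m)
    (lam nu : Fin k → ℤ) (h : (∑ i : Fin k, (lam i + nu i)) = 0) :
    ∃ S : Finset ((Fin k → ℕ) × (Fin k → ℕ)),
      IsChiBasis k m S ∧ (∑ p ∈ S, chiWt k lam nu p) ≤ 0 := by
  obtain ⟨j, rfl⟩ : ∃ j, m = j + 2 := ⟨m - 2, by omega⟩
  obtain ⟨f, hf, hs⟩ := HasChain.mixed hk h j
  have hlen : ((2 * k * (j + 1) - 1 : ℕ) : ℤ) = 2 * (k * (j + 1)) - 1 := by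
    have : 1 ≤ 2 * k * (j + 1) := Nat.mul_pos (by omega) (by omega)
    rw [Nat.cast_sub this]
    push_cast
    ring
  have hdeg : (k : ℤ) * (((j + 2 : ℕ) : ℤ) - 1) - 1 = k * (j + 1) - 1 := by
    push_cast
    ring
  set n := 2 * k * (j + 1) - 1 with hn
  have inj : Set.InjOn f (Finset.range n) := by
    intro a ha b hb hab
    rw [Finset.mem_coe, Finset.mem_range] at ha hb
    have h₁ := (hf a ha).2
    rw [hab, (hf b hb).2] at h₁
    omega
  refine ⟨(Finset.range n).image f, ⟨?_, ?_, ?_, ?_⟩, ?_⟩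
  · rw [Finset.card_image_of_injOn inj, Finset.card_range, hn]
    rfl
  · intro p hp
    obtain ⟨a, ha, rfl⟩ := Finset.mem_image.mp hp
    obtain ⟨⟨h₁, h₂, h₃⟩, -⟩ := hf a (Finset.mem_range.mp ha)
    refine ⟨by rw [Finset.sum_add_distrib, h₁], fun h₀ => ?_, fun h₀ => ?_⟩
    · simp [h₀] at h₂
    · simp [h₀] at h₃
  · intro p hp
    obtain ⟨a, ha, rfl⟩ := Finset.mem_image.mp hp
    rw [Finset.mem_range] at ha
    rw [hdeg, (hf a ha).2]
    constructor <;> omega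
  · intro d hd₁ hd₂
    rw [hdeg] at hd₁ hd₂
    obtain ⟨a, ha⟩ := Int.eq_ofNat_of_zero_le (sub_nonneg.mpr hd₂)
    have han : a < n := by omega
    rw [Finset.card_eq_one]
    refine ⟨f a, ?_⟩
    ext p
    simp only [Finset.mem_filter, Finset.mem_image, Finset.mem_range, Finset.mem_singleton]
    constructor
    · rintro ⟨⟨b, hb, rfl⟩, hbd⟩
      rw [(hf b hb).2] at hbd
      congr 1
      omega
    · rintro rfl
      refine ⟨⟨a, han, rfl⟩, ?_⟩
      rw [(hf a han).2]
      omega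
  · rw [Finset.sum_image inj]
    rw [mul_zero] at hs
    exact_mod_cast hs
end
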